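/- For every non-negative integer ℓ, the functions P_ℓ and Q_ℓ agree on (0,∞)^r with polynomials in x_1,…,x_r having rational coefficients and total degree exactly nℓ + r; moreover the polynomial Q_ℓ is homogeneous of degree nℓ + r. -/

import Mathlib

open MeasureTheory Complex RealInnerProductSpace
open scoped Classical

noncomputable section

/-- The data of a reduced crystallographic root system `Φ` spanning a real inner
product space `E`, together with a choice of positive system `Φ⁺`, an ordering
of the simple roots, and the corresponding fundamental dominant weights. -/
structure RootSystemData (r : ℕ) (E : Type*) [NormedAddCommGroup E] [InnerProductSpace ℝ E] where
  /-- the set of roots -/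
  roots : Finset E
  /-- the set of positive roots -/
  pos : Finset E
  /-- the (ordered) simple roots of the positive system -/
  simple : Fin r → E
  /-- the fundamental dominant weights -/
  weight : Fin r → E
  ne_zero : ∀ α ∈ roots, α ≠ (0 : E)
  span_eq : Submodule.span ℝ (roots : Set E) = ⊤
  reduced : ∀ α ∈ roots, ∀ c : ℝ, c • α ∈ roots → c = 1 ∨ c = -1
  crystallographic : ∀ α ∈ roots, ∀ β ∈ roots, ∃ z : ℤ, 2 * ⟪β, α⟫ / ⟪α, α⟫ = (z : ℝ)
  reflection_mem : ∀ α ∈ roots, ∀ β ∈ roots, β - (2 * ⟪β, α⟫ / ⟪α, α⟫) • α ∈ roots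
  pos_subset : pos ⊆ roots
  mem_pos_or : ∀ α ∈ roots, α ∈ pos ∨ -α ∈ pos
  not_both : ∀ α ∈ pos, -α ∉ pos
  simple_mem_pos : ∀ i, simple i ∈ pos
  simple_inj : Function.Injective simple
  simple_base : ∀ α ∈ pos, ∃ c : Fin r → ℕ, α = ∑ i, (c i : ℝ) • simple i
  weight_dual : ∀ i j, ⟪weight i, (2 / ⟪simple j, simple j⟫) • simple j⟫ = (if i = j then (1:ℝ) else 0)

variable {r : ℕ} {E : Type*} [NormedAddCommGroup E] [InnerProductSpace ℝ E]

/-- The pairing `(λ_i, α^∨)` of the `i`-th fundamental weight with the coroot of `α`. -/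
def RootSystemData.pairing (S : RootSystemData r E) (i : Fin r) (α : E) : ℝ :=
  ⟪S.weight i, (2 / ⟪α, α⟫) • α⟫

/-- The zeta series `ζ_Φ(s,x)` attached to the root system data. -/
def zetaRS (S : RootSystemData r E) (s : ℂ) (x : Fin r → ℝ) : ℂ :=
  ∑' m : Fin r → ℕ, ∏ α ∈ S.pos,
    (((∑ i, ((m i : ℝ) + x i) * S.pairing i α : ℝ)) : ℂ) ^ (-s)

/-- The zeta integral `𝒵_Φ(s,x)` attached to the root system data. -/
def zetaIntRS (S : RootSystemData r E) (s : ℂ) (x : Fin r → ℝ) : ℂ :=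
  ∫ t in {t : Fin r → ℝ | ∀ i, 0 < t i}, ∏ α ∈ S.pos,
    (((∑ i, (t i + x i) * S.pairing i α : ℝ)) : ℂ) ^ (-s)

/-- `v` is the value `P_ℓ(x) = ζ_Φ(-ℓ,x)` of the meromorphic continuation of the
zeta series at `s = -ℓ`. -/
def IsPValue (S : RootSystemData r E) (l : ℕ) (x : Fin r → ℝ) (v : ℂ) : Prop :=
  ∃ F : ℂ → ℂ, (∀ s : ℂ, (r : ℝ) < s.re → F s = zetaRS S s x) ∧
    MeromorphicOn F Set.univ ∧ AnalyticAt ℂ F (-(l : ℂ)) ∧ F (-(l : ℂ)) = v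

/-- `v` is the value `Q_ℓ(x) = 𝒵_Φ(-ℓ,x)` of the meromorphic continuation of the
zeta integral at `s = -ℓ`. -/
def IsQValue (S : RootSystemData r E) (l : ℕ) (x : Fin r → ℝ) (v : ℂ) : Prop :=
  ∃ F : ℂ → ℂ, (∀ s : ℂ, (r : ℝ) < s.re → F s = zetaIntRS S s x) ∧
    MeromorphicOn F Set.univ ∧ AnalyticAt ℂ F (-(l : ℂ)) ∧ F (-(l : ℂ)) = v

open Filter Topology ContDiff

/-- The index `i` is supported in `A`, with respect to the matrix `a`. -/
def SupportedIn {ι κ : Type*} (a : κ → ι → ℕ) (A : Finset ι) (i : κ) : Prop :=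
  ∀ α, a i α ≠ 0 → α ∈ A

/-- The exponents `c` of the variables dominate the exponents `q` of the linear forms on every
coordinate subspace. -/
def Admissible {ι κ : Type*} [Fintype κ] (a : κ → ι → ℕ) (c : ι → ℝ) (q : κ → ℕ) : Prop :=
  ∀ A : Finset ι, ∑ i, (if SupportedIn a A i then (q i : ℝ) else 0) ≤ ∑ α ∈ A, c α

/-- The linear forms with coefficient matrix `a`, in exponential coordinates. -/
def expForm {ι κ : Type*} [Fintype ι] (a : κ → ι → ℕ) (i : κ) (τ : ι → ℝ) : ℝ :=
  ∑ α, (a i α : ℝ) * Real.exp (τ α)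

lemma Admissible.sum_selection_le {ι κ : Type*} [Fintype ι] [Fintype κ] {a : κ → ι → ℕ}
    {c : ι → ℝ} {q : κ → ℕ} (h : Admissible a c q) {m : κ → ι} (hm : ∀ i, a i (m i) ≠ 0)
    (f : ι → ℝ) (hf : ∀ α, 0 ≤ f α) (hfm : ∀ i α, a i α ≠ 0 → f (m i) ≤ f α) :
    ∑ i, (q i : ℝ) * f (m i) ≤ ∑ α, c α * f α := by
  induction hN : (Finset.univ.filter fun α => f α ≠ 0).card using Nat.strong_induction_on
    generalizing f with
  | _ N ih =>
    set A := Finset.univ.filter fun α => f α ≠ 0 with hA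
    by_cases hne : A.Nonempty
    · obtain ⟨β, hβA, hβ⟩ := A.exists_min_image f hne
      set μ := f β with hμ
      have hμ0 : 0 < μ := lt_of_le_of_ne (hf β) (Ne.symm (by simpa [hA] using hβA))
      let f' : ι → ℝ := fun α => if α ∈ A then f α - μ else 0
      have hfz : ∀ α, α ∉ A → f α = 0 := fun α hα => by simpa [hA] using hα
      have hdecomp : ∀ α, f α = f' α + if α ∈ A then μ else 0 := by
        intro α
        by_cases hα : α ∈ A
        · simp [f', hα]
        · simp [f', hα, hfz α hα]
      have hsupp : ∀ i, m i ∈ A ↔ SupportedIn a A i := by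
        intro i
        constructor
        · intro hi α hα
          by_contra hαA
          have := hfm i α hα
          rw [hfz α hαA] at this
          linarith [hβ _ hi]
        · intro hi
          exact hi _ (hm i)
      have key := ih (Finset.univ.filter fun α => f' α ≠ 0).card (by
        rw [← hN]
        apply Finset.card_lt_card
        refine ⟨?_, ?_⟩
        · intro α hα
          by_contra hαA
          simp [f', hαA] at hα
        · intro hsub
          have := hsub hβA
          simp [f', hμ] at this) f' (by
        intro α
        by_cases hα : α ∈ A
        · simpa [f', hα] using hβ α hα
        · simp [f', hα]) (by
        intro i α hα
        by_cases h1 : m i ∈ A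
        · have h2 := (hsupp i).1 h1 α hα
          simpa [f', h1, h2] using hfm i α hα
        · by_cases h2 : α ∈ A
          · simpa [f', h1, h2] using hβ α h2
          · simp [f', h1, h2]) rfl
      have e1 : ∑ i, (q i : ℝ) * f (m i)
          = ∑ i, (q i : ℝ) * f' (m i) + μ * ∑ i, (if SupportedIn a A i then (q i : ℝ) else 0) := by
        rw [Finset.mul_sum, ← Finset.sum_add_distrib]
        refine Finset.sum_congr rfl fun i _ => ?_
        rw [hdecomp (m i)]
        by_cases h1 : m i ∈ A
        · simp [h1, (hsupp i).1 h1]; ring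
        · simp [h1, mt (hsupp i).2 h1]
      have e2 : ∑ α, c α * f α = ∑ α, c α * f' α + μ * ∑ α ∈ A, c α := by
        rw [Finset.mul_sum, ← Finset.sum_filter_add_sum_filter_not Finset.univ (· ∈ A) (fun α => c α * f α),
          ← Finset.sum_filter_add_sum_filter_not Finset.univ (· ∈ A) (fun α => c α * f' α)]
        have h1 : ∑ α with α ∉ A, c α * f α = 0 := Finset.sum_eq_zero fun α hα => by
          rw [hfz α (by simpa using hα), mul_zero]
        have h2 : ∑ α with α ∉ A, c α * f' α = 0 := Finset.sum_eq_zero fun α hα => by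
          simp only [Finset.mem_filter] at hα; simp [f', hα.2]
        rw [h1, h2, Finset.filter_mem_eq_inter, Finset.univ_inter, add_zero, add_zero,
          ← Finset.sum_add_distrib]
        refine Finset.sum_congr rfl fun α hα => ?_
        simp [f', hα]; ring
      rw [e1, e2]
      have := mul_le_mul_of_nonneg_left (h A) hμ0.le
      linarith
    · have hz : ∀ α, f α = 0 := fun α => by
        by_contra hα
        exact hne ⟨α, by simp [hA, hα]⟩
      simp [hz]

lemma exp_le_expForm {ι κ : Type*} [Fintype ι] {a : κ → ι → ℕ} {i : κ} {α : ι} (h : a i α ≠ 0)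
    (τ : ι → ℝ) : Real.exp (τ α) ≤ expForm a i τ := by
  have h1 : (1 : ℝ) ≤ a i α := by exact_mod_cast Nat.one_le_iff_ne_zero.2 h
  calc Real.exp (τ α) ≤ (a i α : ℝ) * Real.exp (τ α) :=
        le_mul_of_one_le_left (Real.exp_pos _).le h1
    _ ≤ _ := Finset.single_le_sum (f := fun α => (a i α : ℝ) * Real.exp (τ α))
        (fun β _ => by positivity) (Finset.mem_univ α)

lemma expForm_pos {ι κ : Type*} [Fintype ι] {a : κ → ι → ℕ} {i : κ} (h : ∃ α, a i α ≠ 0)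
    (τ : ι → ℝ) : 0 < expForm a i τ := by
  obtain ⟨α, hα⟩ := h
  exact (Real.exp_pos _).trans_le (exp_le_expForm hα τ)

lemma exists_argmax_support {ι κ : Type*} [Fintype ι] {a : κ → ι → ℕ}
    (ha : ∀ i, ∃ α, a i α ≠ 0) (τ : ι → ℝ) :
    ∃ m : κ → ι, (∀ i, a i (m i) ≠ 0) ∧ ∀ i α, a i α ≠ 0 → τ α ≤ τ (m i) := by
  have : ∀ i, ∃ β, a i β ≠ 0 ∧ ∀ α, a i α ≠ 0 → τ α ≤ τ β := by
    intro i
    obtain ⟨β, hβ, h⟩ := (Finset.univ.filter fun α => a i α ≠ 0).exists_max_image τ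
      (by obtain ⟨α, hα⟩ := ha i; exact ⟨α, by simp [hα]⟩)
    exact ⟨β, by simpa using hβ, fun α hα => h α (by simp [hα])⟩
  choose m hm using this
  exact ⟨m, fun i => (hm i).1, fun i => (hm i).2⟩

lemma supportedIn_univ {ι κ : Type*} [Fintype ι] (a : κ → ι → ℕ) (i : κ) :
    SupportedIn a Finset.univ i := fun _ _ => Finset.mem_univ _

lemma Admissible.sum_sub_selection_le {ι κ : Type*} [Fintype ι] [Fintype κ] {a : κ → ι → ℕ}
    {c : ι → ℝ} {q : κ → ℕ} (h : Admissible a c q) {m : κ → ι} (hm : ∀ i, a i (m i) ≠ 0)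
    {τ : ι → ℝ} (hτm : ∀ i α, a i α ≠ 0 → τ α ≤ τ (m i)) {M : ℝ} (hM : ∀ α, τ α ≤ M) :
    ∑ α, c α * τ α - ∑ i, (q i : ℝ) * τ (m i) ≤ (∑ α, c α - ∑ i, (q i : ℝ)) * M := by
  have := h.sum_selection_le hm (fun α => M - τ α) (fun α => sub_nonneg.2 (hM α))
    (fun i α hα => by have := hτm i α hα; linarith)
  simp only [mul_sub, Finset.sum_sub_distrib, ← Finset.sum_mul] at this
  linarith

lemma Admissible.total_nonneg {ι κ : Type*} [Fintype ι] [Fintype κ] {a : κ → ι → ℕ}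
    {c : ι → ℝ} {q : κ → ℕ} (h : Admissible a c q) : 0 ≤ ∑ α, c α - ∑ i, (q i : ℝ) := by
  have := h Finset.univ
  simp only [supportedIn_univ, if_true] at this
  linarith

lemma Admissible.exp_div_le {ι κ : Type*} [Fintype ι] [Fintype κ] {a : κ → ι → ℕ}
    (ha : ∀ i, ∃ α, a i α ≠ 0) {c : ι → ℝ} {q : κ → ℕ} (h : Admissible a c q) {τ : ι → ℝ} {M : ℝ}
    (hM : ∀ α, τ α ≤ M) :
    Real.exp (∑ α, c α * τ α) / ∏ i, expForm a i τ ^ q i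
      ≤ Real.exp ((∑ α, c α - ∑ i, (q i : ℝ)) * M) := by
  obtain ⟨m, hm, hτm⟩ := exists_argmax_support ha τ
  have h1 : Real.exp (∑ i, (q i : ℝ) * τ (m i)) ≤ ∏ i, expForm a i τ ^ q i := by
    rw [Real.exp_sum]
    refine Finset.prod_le_prod (fun i _ => (Real.exp_pos _).le) fun i _ => ?_
    rw [Real.exp_nat_mul]
    exact pow_le_pow_left₀ (Real.exp_pos _).le (exp_le_expForm (hm i) τ) _
  calc _ ≤ Real.exp (∑ α, c α * τ α) / Real.exp (∑ i, (q i : ℝ) * τ (m i)) :=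
        div_le_div_of_nonneg_left (Real.exp_pos _).le (Real.exp_pos _) h1
    _ = Real.exp (∑ α, c α * τ α - ∑ i, (q i : ℝ) * τ (m i)) := (Real.exp_sub _ _).symm
    _ ≤ _ := Real.exp_le_exp.2 (h.sum_sub_selection_le hm hτm hM)

lemma sum_exp_le_sum_expForm {ι κ : Type*} [Fintype ι] [Fintype κ] {a : κ → ι → ℕ}
    (ha' : ∀ α, ∃ i, a i α ≠ 0) (τ : ι → ℝ) :
    ∑ α, Real.exp (τ α) ≤ ∑ i, expForm a i τ := by
  unfold expForm
  rw [Finset.sum_comm]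
  refine Finset.sum_le_sum fun α _ => ?_
  obtain ⟨i, hi⟩ := ha' α
  have h1 : (1 : ℝ) ≤ a i α := by exact_mod_cast Nat.one_le_iff_ne_zero.2 hi
  exact (le_mul_of_one_le_left (Real.exp_pos _).le h1).trans
    (Finset.single_le_sum (f := fun i => (a i α : ℝ) * Real.exp (τ α))
      (fun β _ => by positivity) (Finset.mem_univ i))

lemma exists_mul_le_add_exp {d δ : ℝ} (hd : 0 ≤ d) (hδ : 0 < δ) :
    ∃ K, ∀ y : ℝ, d * y ≤ K + δ * Real.exp y := by
  refine ⟨d ^ 2 / δ, fun y => ?_⟩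
  have hK : 0 ≤ d ^ 2 / δ := by positivity
  rcases le_total y 0 with hy | hy
  · have := mul_nonneg hδ.le (Real.exp_pos y).le
    nlinarith [mul_nonneg hd (neg_nonneg.2 hy)]
  · have h1 := Real.quadratic_le_exp_of_nonneg hy
    have h2 : d * y ≤ d ^ 2 / δ + δ * (y ^ 2 / 2) := by
      have : d ^ 2 / δ + δ * (y ^ 2 / 2) - d * y
          = ((d - δ * y / 2) ^ 2 + δ ^ 2 * y ^ 2 / 4) / δ := by field_simp; ring
      have : 0 ≤ d ^ 2 / δ + δ * (y ^ 2 / 2) - d * y := by rw [this]; positivity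
      linarith
    nlinarith [mul_le_mul_of_nonneg_left h1 hδ.le, mul_nonneg hδ.le hy]

/-- The function decays exponentially on the positive half-line. -/
def ExpDecay (g : ℝ → ℝ) : Prop := ∃ C δ : ℝ, 0 < δ ∧ ∀ u, 0 < u → |g u| ≤ C * Real.exp (-δ * u)

/-- The integrand, in exponential coordinates, of the Mellin transform of
`∏ i, g i (u i) / u i ^ q i` where the `u i` are the linear forms with coefficients `a`. -/
def mellinIntegrand {ι κ : Type*} [Fintype ι] [Fintype κ] (a : κ → ι → ℕ) (p : ι → ℕ) (q : κ → ℕ)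
    (g : κ → ℝ → ℝ) (s : ℂ) (τ : ι → ℝ) : ℂ :=
  Complex.exp (∑ α, (s + p α) * τ α) * (∏ i, g i (expForm a i τ) / expForm a i τ ^ q i : ℝ)

lemma ExpDecay.uniform {κ : Type*} [Fintype κ] {g : κ → ℝ → ℝ} (hg : ∀ i, ExpDecay (g i)) :
    ∃ C δ : ℝ, 0 ≤ C ∧ 0 < δ ∧ ∀ i u, 0 < u → |g i u| ≤ C * Real.exp (-δ * u) := by
  choose C δ hδ h using hg
  obtain ⟨ε, hε, hε'⟩ : ∃ ε > 0, ∀ i, ε ≤ δ i := by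
    rcases isEmpty_or_nonempty κ with hκ | hκ
    · exact ⟨1, one_pos, fun i => hκ.elim i⟩
    · obtain ⟨j, -, hj⟩ := Finset.univ.exists_min_image δ Finset.univ_nonempty
      exact ⟨δ j, hδ j, fun i => hj i (Finset.mem_univ i)⟩
  refine ⟨∑ i, |C i|, ε, Finset.sum_nonneg fun _ _ => abs_nonneg _, hε, fun i u hu => ?_⟩
  refine (h i u hu).trans ?_
  have h1 : C i ≤ ∑ i, |C i| := (le_abs_self _).trans
    (Finset.single_le_sum (f := fun i => |C i|) (fun _ _ => abs_nonneg _) (Finset.mem_univ i))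
  have h2 : Real.exp (-δ i * u) ≤ Real.exp (-ε * u) :=
    Real.exp_le_exp.2 (by nlinarith [hε' i])
  exact mul_le_mul h1 h2 (Real.exp_pos _).le (Finset.sum_nonneg fun _ _ => abs_nonneg _)

lemma continuous_expForm {ι κ : Type*} [Fintype ι] (a : κ → ι → ℕ) (i : κ) :
    Continuous (expForm a i) := by
  unfold expForm
  fun_prop

lemma norm_exp_sum_mul {ι : Type*} [Fintype ι] (s : ℂ) (p : ι → ℕ) (τ : ι → ℝ) :
    ‖Complex.exp (∑ α, (s + p α) * τ α)‖ = Real.exp (∑ α, (s.re + p α) * τ α) := by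
  rw [Complex.norm_exp, Complex.re_sum]
  simp

lemma norm_mellinIntegrand_le {ι κ : Type*} [Fintype ι] [Fintype κ] [Nonempty ι] {a : κ → ι → ℕ}
    (ha : ∀ i, ∃ α, a i α ≠ 0) (ha' : ∀ α, ∃ i, a i α ≠ 0) {lam : ℝ} {p : ι → ℕ} {q : κ → ℕ}
    (h : Admissible a (fun α => p α - lam) q) {g : κ → ℝ → ℝ} (hg : ∀ i, ExpDecay (g i)) :
    ∃ K δ : ℝ, 0 ≤ K ∧ 0 < δ ∧ ∀ s τ, ‖mellinIntegrand a p q g s τ‖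
      ≤ K * ∏ α, Real.exp ((s.re + lam) * τ α - δ * Real.exp (τ α)) := by
  obtain ⟨C, δ, hC, hδ, hb⟩ := ExpDecay.uniform hg
  set d := ∑ α, ((p α : ℝ) - lam) - ∑ i, (q i : ℝ) with hd
  obtain ⟨K, hK⟩ := exists_mul_le_add_exp (d := d) h.total_nonneg (half_pos hδ)
  refine ⟨C ^ Fintype.card κ * Real.exp K, δ / 2, by positivity, half_pos hδ, fun s τ => ?_⟩
  obtain ⟨β, -, hβ⟩ := Finset.univ.exists_max_image τ Finset.univ_nonempty
  have h1 := h.exp_div_le ha (M := τ β) fun α => hβ α (Finset.mem_univ α)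
  have hU : ∀ i, 0 < expForm a i τ := fun i => expForm_pos (ha i) τ
  have h2 : |∏ i, g i (expForm a i τ)| ≤ C ^ Fintype.card κ * Real.exp (-δ * ∑ α, Real.exp (τ α)) := by
    rw [Finset.abs_prod]
    calc _ ≤ ∏ i, C * Real.exp (-δ * expForm a i τ) :=
          Finset.prod_le_prod (fun i _ => abs_nonneg _) fun i _ => hb i _ (hU i)
      _ = C ^ Fintype.card κ * Real.exp (-δ * ∑ i, expForm a i τ) := by
          rw [Finset.prod_mul_distrib, ← Real.exp_sum, Finset.mul_sum]; simp
      _ ≤ _ := by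
          refine mul_le_mul_of_nonneg_left (Real.exp_le_exp.2 ?_) (by positivity)
          nlinarith [sum_exp_le_sum_expForm ha' τ]
  have hsum : Real.exp (τ β) ≤ ∑ α, Real.exp (τ α) :=
    Finset.single_le_sum (f := fun α => Real.exp (τ α)) (fun _ _ => (Real.exp_pos _).le)
      (Finset.mem_univ β)
  have e : ‖mellinIntegrand a p q g s τ‖ = Real.exp (∑ α, (s.re + lam) * τ α) *
      (Real.exp (∑ α, ((p α : ℝ) - lam) * τ α) / ∏ i, expForm a i τ ^ q i) *
        |∏ i, g i (expForm a i τ)| := by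
    rw [mellinIntegrand, norm_mul, norm_exp_sum_mul, Complex.norm_real, Finset.prod_div_distrib,
      Real.norm_eq_abs, abs_div, abs_of_pos (Finset.prod_pos fun i _ => pow_pos (hU i) _)]
    have : ∑ α, (s.re + p α) * τ α
        = ∑ α, (s.re + lam) * τ α + ∑ α, ((p α : ℝ) - lam) * τ α := by
      rw [← Finset.sum_add_distrib]; exact Finset.sum_congr rfl fun α _ => by ring
    rw [this, Real.exp_add]
    ring
  rw [e, ← Real.exp_sum]
  calc _ ≤ Real.exp (∑ α, (s.re + lam) * τ α) * Real.exp (d * τ β) *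
        (C ^ Fintype.card κ * Real.exp (-δ * ∑ α, Real.exp (τ α))) := by gcongr
    _ = C ^ Fintype.card κ *
        Real.exp (∑ α, (s.re + lam) * τ α + d * τ β + -δ * ∑ α, Real.exp (τ α)) := by
        rw [Real.exp_add, Real.exp_add]; ring
    _ ≤ C ^ Fintype.card κ *
        Real.exp (K + ∑ α, ((s.re + lam) * τ α - δ / 2 * Real.exp (τ α))) := by
        refine mul_le_mul_of_nonneg_left (Real.exp_le_exp.2 ?_) (by positivity)
        rw [Finset.sum_sub_distrib, ← Finset.mul_sum Finset.univ (fun α => Real.exp (τ α)) (δ / 2)]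
        nlinarith [hK (τ β)]
    _ = _ := by rw [Real.exp_add]; ring

lemma integrable_exp_sub_exp {c δ : ℝ} (hc : 0 < c) (hδ : 0 < δ) :
    Integrable fun τ : ℝ => Real.exp (c * τ - δ * Real.exp τ) := by
  have h := integrableOn_rpow_mul_exp_neg_mul_rpow (p := 1) (s := c - 1) (b := δ) (by linarith)
    one_pos hδ
  have h2 := (integrableOn_image_iff_integrableOn_abs_deriv_smul (s := Set.univ) (f := Real.exp)
    (f' := Real.exp) MeasurableSet.univ (fun x _ => (Real.hasDerivAt_exp x).hasDerivWithinAt)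
    Real.exp_injective.injOn (fun x : ℝ => x ^ (c - 1) * Real.exp (-δ * x ^ (1 : ℝ)))).1
    (by simpa [Set.image_univ, Real.range_exp] using h)
  rw [integrableOn_univ] at h2
  refine h2.congr (ae_of_all _ fun τ => ?_)
  simp only [Real.abs_exp, smul_eq_mul, Real.rpow_one]
  rw [← Real.exp_mul, ← Real.exp_add, ← Real.exp_add]
  congr 1; ring

lemma integrable_prod_exp_sub_exp {ι : Type*} [Fintype ι] {c δ : ℝ} (hc : 0 < c) (hδ : 0 < δ) :
    Integrable fun τ : ι → ℝ => ∏ α, Real.exp (c * τ α - δ * Real.exp (τ α)) :=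
  Integrable.fintype_prod fun _ => integrable_exp_sub_exp hc hδ

lemma continuous_mellinIntegrand {ι κ : Type*} [Fintype ι] [Fintype κ] {a : κ → ι → ℕ}
    (ha : ∀ i, ∃ α, a i α ≠ 0) (p : ι → ℕ) (q : κ → ℕ) {g : κ → ℝ → ℝ}
    (hgc : ∀ i, Continuous (g i)) (s : ℂ) : Continuous (mellinIntegrand a p q g s) := by
  unfold mellinIntegrand
  refine Continuous.mul (by fun_prop) (Complex.continuous_ofReal.comp ?_)
  refine continuous_finsetProd _ fun i _ => Continuous.div ?_ ?_ fun τ => ?_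
  · exact (hgc i).comp (continuous_expForm a i)
  · exact (continuous_expForm a i).pow _
  · exact pow_ne_zero _ (expForm_pos (ha i) τ).ne'

lemma integrable_mellinIntegrand {ι κ : Type*} [Fintype ι] [Fintype κ] [Nonempty ι]
    {a : κ → ι → ℕ} (ha : ∀ i, ∃ α, a i α ≠ 0) (ha' : ∀ α, ∃ i, a i α ≠ 0) {lam : ℝ} {p : ι → ℕ}
    {q : κ → ℕ} (h : Admissible a (fun α => p α - lam) q) {g : κ → ℝ → ℝ}
    (hgc : ∀ i, Continuous (g i)) (hg : ∀ i, ExpDecay (g i)) {s : ℂ} (hs : -lam < s.re) :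
    Integrable (mellinIntegrand a p q g s) := by
  obtain ⟨K, δ, -, hδ, hK⟩ := norm_mellinIntegrand_le ha ha' h hg
  refine ((integrable_prod_exp_sub_exp (ι := ι) (c := s.re + lam) (by linarith) hδ).const_mul
    K).mono' (continuous_mellinIntegrand ha p q hgc s).aestronglyMeasurable (ae_of_all _ (hK s))

/-- The Mellin transform of `∏ i, g i (u i) / u i ^ q i`, at the exponents `s + p α`. -/
def mellinForm {ι κ : Type*} [Fintype ι] [Fintype κ] (a : κ → ι → ℕ) (p : ι → ℕ) (q : κ → ℕ)
    (g : κ → ℝ → ℝ) (s : ℂ) : ℂ :=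
  ∫ τ, mellinIntegrand a p q g s τ

lemma abs_le_exp_add_exp_neg (x : ℝ) : |x| ≤ Real.exp x + Real.exp (-x) := by
  rw [abs_le]
  constructor
  · have := Real.add_one_le_exp (-x); have := Real.exp_pos x; linarith
  · have := Real.add_one_le_exp x; have := Real.exp_pos (-x); linarith

lemma differentiableOn_mellinForm {ι κ : Type*} [Fintype ι] [Fintype κ] [Nonempty ι]
    {a : κ → ι → ℕ} (ha : ∀ i, ∃ α, a i α ≠ 0) (ha' : ∀ α, ∃ i, a i α ≠ 0) {lam : ℝ} {p : ι → ℕ}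
    {q : κ → ℕ} (h : Admissible a (fun α => p α - lam) q) {g : κ → ℝ → ℝ}
    (hgc : ∀ i, Continuous (g i)) (hg : ∀ i, ExpDecay (g i)) :
    DifferentiableOn ℂ (mellinForm a p q g) {s | -lam < s.re} := by
  intro s hs
  obtain ⟨K, δ, hK0, hδ, hK⟩ := norm_mellinIntegrand_le ha ha' h hg
  set ε := (s.re + lam) / 4 with hε
  have hε0 : 0 < ε := by have : -lam < s.re := hs; linarith
  set P : ℝ → (ι → ℝ) → ℝ := fun c τ => ∏ α, Real.exp (c * τ α - δ * Real.exp (τ α)) with hP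
  have hPexp : ∀ c e τ, P c τ * Real.exp (e * ∑ α, τ α) = P (c + e) τ := by
    intro c e τ
    simp only [hP, ← Real.exp_sum, ← Real.exp_add, Finset.mul_sum, ← Finset.sum_add_distrib]
    congr 1
    exact Finset.sum_congr rfl fun α _ => by ring
  have hPpos : ∀ c τ, 0 ≤ P c τ := fun c τ => Finset.prod_nonneg fun _ _ => (Real.exp_pos _).le
  have hPint : ∀ c, 0 < c → Integrable (P c) := fun c hc => integrable_prod_exp_sub_exp hc hδ
  let bound : (ι → ℝ) → ℝ := fun τ =>
    K * ε⁻¹ * (P (6 * ε) τ + P (4 * ε) τ + P (4 * ε) τ + P (2 * ε) τ)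
  have hder : ∀ τ : ι → ℝ, ∀ z : ℂ, HasDerivAt (fun z => mellinIntegrand a p q g z τ)
      ((∑ α, (τ α : ℂ)) * mellinIntegrand a p q g z τ) z := by
    intro τ z
    unfold mellinIntegrand
    have h1 : HasDerivAt (fun z : ℂ => ∑ α, (z + p α) * (τ α : ℂ)) (∑ α, (τ α : ℂ)) z := by
      have := HasDerivAt.fun_sum (u := Finset.univ) (x := z)
        (A := fun α (z : ℂ) => (z + p α) * (τ α : ℂ)) (A' := fun α => (τ α : ℂ)) (fun α _ => by
          simpa using ((hasDerivAt_id z).add_const (p α : ℂ)).mul_const (τ α : ℂ))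
      exact this
    convert! (h1.cexp.mul_const _) using 1
    ring
  have hmain := hasDerivAt_integral_of_dominated_loc_of_deriv_le (μ := (volume : Measure (ι → ℝ)))
    (F := fun z τ => mellinIntegrand a p q g z τ)
    (F' := fun z τ => (∑ α, (τ α : ℂ)) * mellinIntegrand a p q g z τ) (x₀ := s)
    (s := Metric.ball s ε) (bound := bound) (Metric.ball_mem_nhds s hε0)
    (Eventually.of_forall fun z => (continuous_mellinIntegrand ha p q hgc z).aestronglyMeasurable)
    (integrable_mellinIntegrand ha ha' h hgc hg hs)
    (Continuous.aestronglyMeasurable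
      ((by fun_prop : Continuous fun τ : ι → ℝ => ∑ α, (τ α : ℂ)).mul
        (continuous_mellinIntegrand ha p q hgc s)))
    (ae_of_all _ fun τ z hz => ?_)
    ((((((hPint _ (by positivity)).add (hPint _ (by positivity))).add
      (hPint _ (by positivity))).add (hPint _ (by positivity)))).const_mul _)
    (ae_of_all _ fun τ z _ => hder τ z)
  · exact hmain.2.differentiableAt.differentiableWithinAt
  · set X := ∑ α, τ α with hX
    have hre : |z.re - s.re| < ε := by
      have := (Complex.abs_re_le_norm (z - s)).trans_lt (mem_ball_iff_norm.1 hz)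
      simpa using this
    have e1 : (∑ α, (τ α : ℂ)) = (X : ℂ) := by simp [hX]
    have h1 : ‖mellinIntegrand a p q g z τ‖ ≤ K * (P (5 * ε) τ + P (3 * ε) τ) := by
      refine (hK z τ).trans (mul_le_mul_of_nonneg_left ?_ hK0)
      change P (z.re + lam) τ ≤ _
      obtain ⟨h3, h4⟩ := abs_lt.1 hre
      have h5 := hPexp (4 * ε) (z.re + lam - 4 * ε) τ
      rw [show 4 * ε + (z.re + lam - 4 * ε) = z.re + lam by ring] at h5
      rw [← h5, ← show 4 * ε + ε = 5 * ε by ring, ← show 4 * ε + -ε = 3 * ε by ring, ← hPexp,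
        ← hPexp (4 * ε) (-ε), ← mul_add]
      refine mul_le_mul_of_nonneg_left ?_ (hPpos _ _)
      rcases le_total 0 X with hX0 | hX0
      · have : Real.exp ((z.re + lam - 4 * ε) * X) ≤ Real.exp (ε * X) :=
          Real.exp_le_exp.2 (mul_le_mul_of_nonneg_right (by linarith) hX0)
        linarith [Real.exp_pos (-ε * X)]
      · have : Real.exp ((z.re + lam - 4 * ε) * X) ≤ Real.exp (-ε * X) :=
          Real.exp_le_exp.2 (mul_le_mul_of_nonpos_right (by linarith) hX0)
        linarith [Real.exp_pos (ε * X)]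
    have h2 : |X| ≤ ε⁻¹ * (Real.exp (ε * X) + Real.exp (-ε * X)) := by
      have := abs_le_exp_add_exp_neg (ε * X)
      rw [abs_mul, abs_of_pos hε0] at this
      rw [neg_mul]
      rwa [le_inv_mul_iff₀ hε0]
    rw [e1, norm_mul, Complex.norm_real, Real.norm_eq_abs]
    calc _ ≤ (ε⁻¹ * (Real.exp (ε * X) + Real.exp (-ε * X))) * (K * (P (5 * ε) τ + P (3 * ε) τ)) :=
          mul_le_mul h2 h1 (norm_nonneg _) (by positivity)
      _ = K * ε⁻¹ * (P (5 * ε) τ * Real.exp (ε * X) + P (5 * ε) τ * Real.exp (-ε * X)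
          + P (3 * ε) τ * Real.exp (ε * X) + P (3 * ε) τ * Real.exp (-ε * X)) := by ring
      _ = bound τ := by
          simp only [hX, hPexp, bound]
          ring_nf

/-- Smooth functions all of whose derivatives decay exponentially on the positive half-line. -/
def RapidlyDecaying (h : ℝ → ℝ) : Prop :=
  ContDiff ℝ ∞ h ∧ ∀ j, ExpDecay (iteratedDeriv j h)

/-- The family of derivatives of `h` of the orders prescribed by `j`. -/
def jet {κ : Type*} (h : κ → ℝ → ℝ) (j : κ → ℕ) (i : κ) : ℝ → ℝ := iteratedDeriv (j i) (h i)

lemma RapidlyDecaying.continuous_jet {κ : Type*} {h : κ → ℝ → ℝ}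
    (hh : ∀ i, RapidlyDecaying (h i)) (j : κ → ℕ) (i : κ) : Continuous (jet h j i) :=
  (hh i).1.continuous_iteratedDeriv (j i) (by exact_mod_cast le_top)

lemma RapidlyDecaying.hasDerivAt_jet {κ : Type*} {h : κ → ℝ → ℝ}
    (hh : ∀ i, RapidlyDecaying (h i)) (j : κ → ℕ) (i : κ) (u : ℝ) :
    HasDerivAt (jet h j i) (iteratedDeriv (j i + 1) (h i) u) u := by
  rw [iteratedDeriv_succ]
  refine DifferentiableAt.hasDerivAt ?_
  exact ((hh i).1.differentiable_iteratedDeriv (j i) (by exact_mod_cast WithTop.coe_lt_top _)) u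

lemma mellinIntegrand_add_single {ι κ : Type*} [Fintype ι] [Fintype κ] (a : κ → ι → ℕ)
    (p : ι → ℕ) (q : κ → ℕ) (g : κ → ℝ → ℝ) (s : ℂ) (τ : ι → ℝ) (β : ι) :
    mellinIntegrand a (p + Pi.single β 1) q g s τ
      = Real.exp (τ β) * mellinIntegrand a p q g s τ := by
  unfold mellinIntegrand
  rw [← mul_assoc]
  congr 1
  rw [Complex.ofReal_exp, ← Complex.exp_add]
  congr 1
  have : (τ β : ℂ) = ∑ α, ((Pi.single β 1 : ι → ℕ) α : ℂ) * τ α := by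
    rw [Finset.sum_eq_single β (fun α _ hα => by simp [hα]) (by simp)]
    simp
  rw [this, ← Finset.sum_add_distrib]
  refine Finset.sum_congr rfl fun α _ => ?_
  push_cast [Pi.add_apply]
  ring

lemma hasDerivAt_expForm {ι κ : Type*} [Fintype ι] (a : κ → ι → ℕ) (i : κ) (A : Finset ι)
    (τ : ι → ℝ) :
    HasDerivAt (fun t : ℝ => expForm a i (τ + t • fun α => if α ∈ A then 1 else 0))
      (∑ α ∈ A, (a i α : ℝ) * Real.exp (τ α)) 0 := by
  unfold expForm
  have : ∑ α ∈ A, (a i α : ℝ) * Real.exp (τ α)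
      = ∑ α, (a i α : ℝ) * (Real.exp (τ α) * if α ∈ A then 1 else 0) := by
    simp
  rw [this]
  refine HasDerivAt.fun_sum fun α _ => HasDerivAt.const_mul _ ?_
  have h1 : HasDerivAt (fun t : ℝ => (τ + t • fun α => if α ∈ A then (1 : ℝ) else 0) α)
      (if α ∈ A then 1 else 0) 0 := by
    simpa using ((hasDerivAt_id (0 : ℝ)).mul_const (if α ∈ A then (1 : ℝ) else 0)).const_add (τ α)
  have h2 := h1.exp
  simpa using h2

lemma hasLineDerivAt_mellinIntegrand {ι κ : Type*} [Fintype ι] [Fintype κ] {a : κ → ι → ℕ}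
    (ha : ∀ i, ∃ α, a i α ≠ 0) (p : ι → ℕ) (q : κ → ℕ) {h : κ → ℝ → ℝ}
    (hh : ∀ i, RapidlyDecaying (h i)) (j : κ → ℕ) (s : ℂ) (A : Finset ι) (τ : ι → ℝ) :
    HasLineDerivAt ℝ (mellinIntegrand a p q (jet h j) s)
      ((∑ α ∈ A, (s + p α) - ∑ i, if SupportedIn a A i then (q i : ℂ) else 0)
          * mellinIntegrand a p q (jet h j) s τ
        + ∑ i, ∑ α ∈ A, (a i α * mellinIntegrand a (p + Pi.single α 1) q
            (jet h (j + Pi.single i 1)) s τ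
          - (if SupportedIn a A i then 0 else (q i * a i α : ℂ)) * mellinIntegrand a
            (p + Pi.single α 1) (q + Pi.single i 1) (jet h j) s τ)) τ
      (fun α => if α ∈ A then 1 else 0) := by
  set v : ι → ℝ := fun α => if α ∈ A then 1 else 0 with hv
  set U : κ → ℝ := fun i => expForm a i τ with hU
  have hU0 : ∀ i, U i ≠ 0 := fun i => (expForm_pos (ha i) τ).ne'
  set UA : κ → ℝ := fun i => ∑ α ∈ A, (a i α : ℝ) * Real.exp (τ α) with hUA
  set G : κ → ℝ := fun i => jet h j i (U i) / U i ^ q i with hG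
  set G1 : κ → ℝ := fun i => iteratedDeriv (j i + 1) (h i) (U i) / U i ^ q i with hG1
  set G2 : κ → ℝ := fun i => jet h j i (U i) / U i ^ (q i + 1) with hG2
  set X : ℂ := Complex.exp (∑ α, (s + p α) * τ α) with hX
  set R : κ → ℂ := fun i => ((∏ k ∈ Finset.univ.erase i, G k : ℝ) : ℂ) with hR
  have hdG : ∀ i, HasDerivAt (fun t : ℝ => jet h j i (expForm a i (τ + t • v))
      / expForm a i (τ + t • v) ^ q i) (UA i * (G1 i - q i * G2 i)) 0 := by
    intro i
    have e0 : expForm a i (τ + (0 : ℝ) • v) = U i := by simp [hU]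
    have h1 := hasDerivAt_expForm a i A τ
    have h2 : HasDerivAt (fun t : ℝ => jet h j i (expForm a i (τ + t • v)))
        (iteratedDeriv (j i + 1) (h i) (U i) * UA i) 0 := by
      have h3 := RapidlyDecaying.hasDerivAt_jet hh j i (U i)
      rw [← e0] at h3
      have := h3.comp (0 : ℝ) h1
      rwa [e0] at this
    have h4 := h2.div (h1.fun_pow (q i)) (by rw [e0]; exact pow_ne_zero _ (hU0 i))
    convert! h4 using 1
    simp only [← hv, e0, hG1, hG2, hUA]
    rcases Nat.eq_zero_or_pos (q i) with hq | hq
    · simp [hq]; ring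
    · obtain ⟨m, hm⟩ := Nat.exists_eq_succ_of_ne_zero hq.ne'
      have := hU0 i
      simp only [hm, Nat.succ_eq_add_one, Nat.add_sub_cancel]
      field_simp
      push_cast
      ring
  have hdP := HasDerivAt.fun_finsetProd (u := Finset.univ) fun i _ => hdG i
  have hdX : HasDerivAt (fun t : ℝ => Complex.exp (∑ α, (s + p α) * ((τ + t • v) α : ℝ)))
      (X * ∑ α ∈ A, (s + p α)) 0 := by
    have h1 : HasDerivAt (fun t : ℝ => ∑ α, (s + p α) * (((τ + t • v) α : ℝ) : ℂ))
        (∑ α ∈ A, (s + p α)) 0 := by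
      have : ∑ α ∈ A, (s + p α) = ∑ α, (s + p α) * (v α : ℂ) := by
        simp [hv, apply_ite Complex.ofReal]
      rw [this]
      refine HasDerivAt.fun_sum fun α _ => HasDerivAt.const_mul _ (HasDerivAt.ofReal_comp ?_)
      simpa using ((hasDerivAt_id (0 : ℝ)).mul_const (v α)).const_add (τ α)
    have h2 := h1.cexp
    simpa [hX] using h2
  have hmain := hdX.mul hdP.ofReal_comp
  unfold HasLineDerivAt
  have eint : mellinIntegrand a p q (jet h j) s τ = X * (∏ i, G i : ℝ) := rfl
  have eT1 : ∀ i α, mellinIntegrand a (p + Pi.single α 1) q (jet h (j + Pi.single i 1)) s τ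
      = Real.exp (τ α) * (X * (R i * G1 i)) := by
    intro i α
    rw [mellinIntegrand_add_single]
    unfold mellinIntegrand
    congr 2
    rw [hR]; simp only
    rw [← Complex.ofReal_mul, ← Finset.prod_erase_mul _ _ (Finset.mem_univ i)]
    congr 2
    · refine Finset.prod_congr rfl fun k hk => ?_
      simp [hG, hU, jet, Finset.ne_of_mem_erase hk]
    · simp [hG1, hU, jet]
  have eT2 : ∀ i α, mellinIntegrand a (p + Pi.single α 1) (q + Pi.single i 1) (jet h j) s τ
      = Real.exp (τ α) * (X * (R i * G2 i)) := by
    intro i α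
    rw [mellinIntegrand_add_single]
    unfold mellinIntegrand
    congr 2
    rw [hR]; simp only
    rw [← Complex.ofReal_mul, ← Finset.prod_erase_mul _ _ (Finset.mem_univ i)]
    congr 2
    · refine Finset.prod_congr rfl fun k hk => ?_
      simp [hG, hU, Finset.ne_of_mem_erase hk]
    · simp [hG2, hU]
  have hGU : ∀ i, ((∏ k, G k : ℝ) : ℂ) = R i * (G2 i * U i : ℝ) := by
    intro i
    rw [hR]; simp only
    rw [← Complex.ofReal_mul, ← Finset.prod_erase_mul _ _ (Finset.mem_univ i)]
    congr 2
    have := hU0 i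
    simp only [hG, hG2]
    field_simp
    ring
  have hUAU : ∀ i, SupportedIn a A i → UA i = U i := by
    intro i hi
    simp only [hUA, hU, expForm]
    refine Finset.sum_subset (Finset.subset_univ A) fun α _ hα => ?_
    have : a i α = 0 := by by_contra h0; exact hα (hi α h0)
    simp [this]
  convert! hmain using 1
  simp only [zero_smul, add_zero, eint, eT1, eT2]
  have e3 : ∀ i, ∑ α ∈ A, ((a i α : ℂ) * (Real.exp (τ α) * (X * (R i * G1 i)))
      - (if SupportedIn a A i then 0 else (q i * a i α : ℂ))
        * (Real.exp (τ α) * (X * (R i * G2 i))))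
      = X * (R i * (UA i * (G1 i - q i * G2 i) : ℝ))
        + (if SupportedIn a A i then (q i : ℂ) else 0) * (X * (∏ i, G i : ℝ)) := by
    intro i
    have e4 : (UA i : ℂ) = ∑ α ∈ A, (a i α : ℂ) * Real.exp (τ α) := by simp [hUA]
    by_cases hi : SupportedIn a A i
    · simp only [hi, if_true, zero_mul, sub_zero]
      rw [hGU i, ← hUAU i hi]
      push_cast
      have : ∑ α ∈ A, (a i α : ℂ) * (Complex.exp (τ α) * (X * (R i * G1 i)))
          = UA i * (X * (R i * G1 i)) := by
        rw [e4, Finset.sum_mul]; exact Finset.sum_congr rfl fun α _ => by push_cast; ring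
      rw [this]; ring
    · simp only [hi, if_false, zero_mul, add_zero]
      push_cast
      rw [e4, Finset.sum_mul, Finset.mul_sum, Finset.mul_sum]
      exact Finset.sum_congr rfl fun α _ => by push_cast; ring
  simp only [e3, Finset.sum_add_distrib, ← Finset.sum_mul, ← Finset.mul_sum]
  have e5 : (((∑ i, (∏ k ∈ Finset.univ.erase i, jet h j k (expForm a k τ) / expForm a k τ ^ q k) •
      (UA i * (G1 i - q i * G2 i))) : ℝ) : ℂ) = ∑ i, R i * (UA i * (G1 i - q i * G2 i) : ℝ) := by
    rw [Complex.ofReal_sum]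
    exact Finset.sum_congr rfl fun i _ => by rw [smul_eq_mul, Complex.ofReal_mul]
  rw [e5]
  have e6 : ∏ x, jet h j x (expForm a x τ) / expForm a x τ ^ q x = ∏ i, G i := rfl
  rw [e6]
  ring

lemma integral_lineDeriv_eq_zero {V : Type*} [NormedAddCommGroup V] [NormedSpace ℝ V]
    [MeasurableSpace V] [BorelSpace V] [FiniteDimensional ℝ V] {μ : Measure V}
    [μ.IsAddHaarMeasure] {f f' : V → ℂ} {v : V} (hf : Integrable f μ) (hf' : Integrable f' μ)
    (hd : ∀ x, HasLineDerivAt ℝ f (f' x) x v) : ∫ x, f' x ∂μ = 0 := by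
  have := integral_bilinear_hasLineDerivAt_right_eq_neg_left_of_integrable (μ := μ)
    (f := fun _ => (1 : ℂ)) (f' := fun _ => 0) (g := f) (g' := f') (v := v)
    (B := ContinuousLinearMap.mul ℝ ℂ) (by simp) (by simpa using hf') (by simpa using hf)
    (fun x _ => by simpa [HasLineDerivAt] using hasDerivAt_const (0 : ℝ) (1 : ℂ))
    (fun x _ => hd x)
  simpa using this

lemma Admissible.add_single_left {ι κ : Type*} [Fintype κ] {a : κ → ι → ℕ}
    {lam : ℝ} {p : ι → ℕ} {q : κ → ℕ} (h : Admissible a (fun α => p α - lam) q) (β : ι) :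
    Admissible a (fun α => (p + Pi.single β 1 : ι → ℕ) α - lam) q := by
  intro A
  refine (h A).trans (Finset.sum_le_sum fun α _ => ?_)
  simp

lemma Admissible.add_single_both {ι κ : Type*} [Fintype κ] {a : κ → ι → ℕ}
    {lam : ℝ} {p : ι → ℕ} {q : κ → ℕ} (h : Admissible a (fun α => p α - lam) q) {β : ι} {k : κ}
    (hk : a k β ≠ 0) :
    Admissible a (fun α => (p + Pi.single β 1 : ι → ℕ) α - lam) (q + Pi.single k 1) := by
  intro B
  have h1 : ∑ i, (if SupportedIn a B i then (((q + Pi.single k 1 : κ → ℕ) i : ℕ) : ℝ) else 0)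
      = ∑ i, (if SupportedIn a B i then (q i : ℝ) else 0)
        + if SupportedIn a B k then 1 else 0 := by
    have : (if SupportedIn a B k then (1 : ℝ) else 0)
        = ∑ i, if SupportedIn a B i then (((Pi.single k 1 : κ → ℕ) i : ℕ) : ℝ) else 0 := by
      rw [Finset.sum_eq_single k (fun i _ hi => by simp [hi]) (by simp)]
      simp
    rw [this, ← Finset.sum_add_distrib]
    refine Finset.sum_congr rfl fun i _ => ?_
    split_ifs <;> simp
  have h2 : ∑ α ∈ B, ((((p + Pi.single β 1 : ι → ℕ) α : ℕ) : ℝ) - lam)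
      = ∑ α ∈ B, ((p α : ℝ) - lam) + if β ∈ B then 1 else 0 := by
    have : (if β ∈ B then (1 : ℝ) else 0) = ∑ α ∈ B, (((Pi.single β 1 : ι → ℕ) α : ℕ) : ℝ) := by
      simp [Pi.single_apply]
    rw [this, ← Finset.sum_add_distrib]
    refine Finset.sum_congr rfl fun α _ => ?_
    push_cast [Pi.add_apply]
    ring
  rw [h1, h2]
  have := h B
  by_cases hB : SupportedIn a B k
  · simp only [hB, hB β hk, if_true]; linarith
  · simp only [hB, if_false, add_zero]; split_ifs <;> linarith

lemma mellinForm_recursion {ι κ : Type*} [Fintype ι] [Fintype κ] [Nonempty ι] {a : κ → ι → ℕ}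
    (ha : ∀ i, ∃ α, a i α ≠ 0) (ha' : ∀ α, ∃ i, a i α ≠ 0) {lam : ℝ} {p : ι → ℕ} {q : κ → ℕ}
    (hadm : Admissible a (fun α => p α - lam) q) {h : κ → ℝ → ℝ}
    (hh : ∀ i, RapidlyDecaying (h i)) (j : κ → ℕ) {s : ℂ} (hs : -lam < s.re) (A : Finset ι) :
    (∑ α ∈ A, (s + p α) - ∑ i, if SupportedIn a A i then (q i : ℂ) else 0)
        * mellinForm a p q (jet h j) s
      = ∑ i, ∑ α ∈ A, ((if SupportedIn a A i then 0 else (q i * a i α : ℂ)) * mellinForm a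
            (p + Pi.single α 1) (q + Pi.single i 1) (jet h j) s
          - a i α * mellinForm a (p + Pi.single α 1) q (jet h (j + Pi.single i 1)) s) := by
  have hc := fun j => RapidlyDecaying.continuous_jet hh j
  have hd : ∀ j : κ → ℕ, ∀ i, ExpDecay (jet h j i) := fun j i => (hh i).2 (j i)
  have i0 := integrable_mellinIntegrand ha ha' hadm (hc j) (hd j) hs
  have i1 : ∀ i α, Integrable fun τ => (a i α : ℂ) * mellinIntegrand a (p + Pi.single α 1) q
      (jet h (j + Pi.single i 1)) s τ := fun i α =>
    (integrable_mellinIntegrand ha ha' (hadm.add_single_left α) (hc _) (hd _) hs).const_mul _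
  have i2 : ∀ i α, Integrable fun τ => (if SupportedIn a A i then 0 else (q i * a i α : ℂ)) *
      mellinIntegrand a (p + Pi.single α 1) (q + Pi.single i 1) (jet h j) s τ := by
    intro i α
    by_cases hz : a i α = 0
    · simp [hz]
    · exact (integrable_mellinIntegrand ha ha' (hadm.add_single_both hz) (hc _) (hd _) hs).const_mul
        _
  have i4 : ∀ i α, Integrable fun τ => (a i α : ℂ) * mellinIntegrand a (p + Pi.single α 1) q
            (jet h (j + Pi.single i 1)) s τ
          - (if SupportedIn a A i then 0 else (q i * a i α : ℂ)) * mellinIntegrand a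
            (p + Pi.single α 1) (q + Pi.single i 1) (jet h j) s τ :=
    fun i α => (i1 i α).sub (i2 i α)
  have i3 : Integrable fun τ => ∑ i, ∑ α ∈ A, ((a i α : ℂ) * mellinIntegrand a (p + Pi.single α 1) q
            (jet h (j + Pi.single i 1)) s τ
          - (if SupportedIn a A i then 0 else (q i * a i α : ℂ)) * mellinIntegrand a
            (p + Pi.single α 1) (q + Pi.single i 1) (jet h j) s τ) :=
    integrable_finsetSum _ fun i _ => integrable_finsetSum _ fun α _ => i4 i α
  have key := integral_lineDeriv_eq_zero i0 ((i0.const_mul _).add i3)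
    (hasLineDerivAt_mellinIntegrand ha p q hh j s A)
  simp only [Pi.add_apply] at key
  rw [integral_add (i0.const_mul _) i3, integral_const_mul, integral_finsetSum _ (fun i _ =>
    integrable_finsetSum _ fun α _ => i4 i α)] at key
  have e : ∀ i, ∫ τ, ∑ α ∈ A, ((a i α : ℂ) * mellinIntegrand a (p + Pi.single α 1) q
            (jet h (j + Pi.single i 1)) s τ
          - (if SupportedIn a A i then 0 else (q i * a i α : ℂ)) * mellinIntegrand a
            (p + Pi.single α 1) (q + Pi.single i 1) (jet h j) s τ)
      = -∑ α ∈ A, ((if SupportedIn a A i then 0 else (q i * a i α : ℂ)) * mellinForm a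
            (p + Pi.single α 1) (q + Pi.single i 1) (jet h j) s
          - a i α * mellinForm a (p + Pi.single α 1) q (jet h (j + Pi.single i 1)) s) := by
    intro i
    rw [integral_finsetSum _ (fun α _ => i4 i α), ← Finset.sum_neg_distrib]
    refine Finset.sum_congr rfl fun α _ => ?_
    rw [integral_sub (i1 i α) (i2 i α), integral_const_mul, integral_const_mul]
    unfold mellinForm
    ring
  simp only [e, Finset.sum_neg_distrib] at key
  exact add_neg_eq_zero.1 key

lemma ae_sum_mul_ne_zero {ι : Type*} [Fintype ι] {c : ι → ℝ} (hc : c ≠ 0) :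
    ∀ᵐ ρ : ι → ℝ, ∑ α, c α * ρ α ≠ 0 := by
  obtain ⟨β, hβ⟩ := Function.ne_iff.1 hc
  set L : (ι → ℝ) →ₗ[ℝ] ℝ := ∑ α, c α • LinearMap.proj α with hL
  have hLa : ∀ ρ, L ρ = ∑ α, c α * ρ α := fun ρ => by simp [hL]
  have hne : LinearMap.ker L ≠ ⊤ := by
    intro h
    have : Pi.single β (1 : ℝ) ∈ LinearMap.ker L := h ▸ Submodule.mem_top
    rw [LinearMap.mem_ker, hLa, Finset.sum_eq_single β (fun α _ hα => by simp [hα]) (by simp)]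
      at this
    simp at this
    exact hβ this
  have := Measure.addHaar_submodule (volume : Measure (ι → ℝ)) (LinearMap.ker L) hne
  rw [ae_iff]
  convert this using 2
  ext ρ
  simp [hLa]

lemma ae_apply_ne_zero {ι : Type*} [Fintype ι] : ∀ᵐ ρ : ι → ℝ, ∀ α, ρ α ≠ 0 := by
  rw [ae_all_iff]
  intro α
  have : (Pi.single α (1 : ℝ) : ι → ℝ) ≠ 0 := by simp
  filter_upwards [ae_sum_mul_ne_zero this] with ρ hρ
  rwa [Finset.sum_eq_single α (fun β _ hβ => by simp [hβ]) (by simp), Pi.single_eq_same,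
    one_mul] at hρ

lemma ae_injective {ι : Type*} [Fintype ι] : ∀ᵐ ρ : ι → ℝ, Function.Injective ρ := by
  have : ∀ᵐ ρ : ι → ℝ, ∀ α β, α ≠ β → ρ α ≠ ρ β := by
    simp only [ae_all_iff]
    intro α β hαβ
    have h0 : (Pi.single α (1 : ℝ) - Pi.single β 1 : ι → ℝ) ≠ 0 := by
      intro h
      have := congrFun h α
      simp [hαβ] at this
    filter_upwards [ae_sum_mul_ne_zero h0] with ρ hρ h
    apply hρ
    simp only [Pi.sub_apply, sub_mul, Finset.sum_sub_distrib]
    rw [Finset.sum_eq_single α (fun γ _ hγ => by simp [hγ]) (by simp),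
      Finset.sum_eq_single β (fun γ _ hγ => by simp [hγ]) (by simp)]
    simp [h]
  filter_upwards [this] with ρ hρ α β h
  by_contra hne
  exact hρ α β hne h

/-- The exponential weight on negative vectors whose entries are ordered according to `σ`. -/
def sectorWeight {ι : Type*} [Fintype ι] (σ : Fin (Fintype.card ι) ≃ ι) (ρ : ι → ℝ) : ℝ :=
  if (∀ α, ρ α < 0) ∧ StrictMono (ρ ∘ σ) then ∏ α, Real.exp (ρ α) else 0

lemma existsUnique_strictMono_comp {ι : Type*} [Fintype ι] {ρ : ι → ℝ}
    (hρ : Function.Injective ρ) : ∃! σ : Fin (Fintype.card ι) ≃ ι, StrictMono (ρ ∘ σ) := by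
  let e := Fintype.equivFin ι
  refine ⟨(Tuple.sort (ρ ∘ e.symm)).trans e.symm, ?_, ?_⟩
  · have h1 : Monotone ((ρ ∘ e.symm) ∘ Tuple.sort (ρ ∘ e.symm)) := Tuple.monotone_sort _
    exact h1.strictMono_of_injective
      ((hρ.comp e.symm.injective).comp (Equiv.injective _))
  · intro σ hσ
    have h1 : Monotone ((ρ ∘ e.symm) ∘ Tuple.sort (ρ ∘ e.symm)) := Tuple.monotone_sort _
    have h2 := h1.strictMono_of_injective
      ((hρ.comp e.symm.injective).comp (Equiv.injective _))
    have h3 := (StrictMono.range_inj hσ h2).1 (by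
      rw [Function.Surjective.range_comp σ.surjective,
        Function.Surjective.range_comp (Equiv.surjective _),
        Function.Surjective.range_comp e.symm.surjective])
    ext i
    exact hρ (congrFun h3 i)

lemma sum_sectorWeight {ι : Type*} [Fintype ι] {ρ : ι → ℝ} (hρ : Function.Injective ρ) :
    ∑ σ, sectorWeight σ ρ = ∏ α, (Set.Iio (0 : ℝ)).indicator Real.exp (ρ α) := by
  obtain ⟨σ, hσ, hu⟩ := existsUnique_strictMono_comp hρ
  rw [Finset.sum_eq_single σ (fun τ _ hτ => ?_) (by simp)]
  · by_cases h : ∀ α, ρ α < 0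
    · simp only [sectorWeight, h, hσ]
      simp [Set.indicator, h]
    · simp only [sectorWeight, h, false_and, if_false]
      push Not at h
      obtain ⟨α, hα⟩ := h
      exact (Finset.prod_eq_zero (Finset.mem_univ α) (by simp [hα])).symm
  · have : ¬ StrictMono (ρ ∘ τ) := fun h => hτ (hu τ h)
    simp [sectorWeight, this]

lemma integrable_prod_indicator_exp {ι : Type*} [Fintype ι] :
    Integrable fun ρ : ι → ℝ => ∏ α, (Set.Iio (0 : ℝ)).indicator Real.exp (ρ α) :=
  Integrable.fintype_prod (f := fun _ : ι => (Set.Iio (0 : ℝ)).indicator Real.exp) fun _ =>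
    (integrable_indicator_iff measurableSet_Iio).2
    ((integrableOn_exp_Iic 0).mono_set Set.Iio_subset_Iic_self)

lemma integral_prod_indicator_exp {ι : Type*} [Fintype ι] :
    ∫ ρ : ι → ℝ, ∏ α, (Set.Iio (0 : ℝ)).indicator Real.exp (ρ α) = 1 := by
  rw [integral_fintype_prod_volume_eq_prod (fun _ : ι => (Set.Iio (0 : ℝ)).indicator Real.exp)]
  rw [integral_indicator measurableSet_Iio, ← integral_Iic_eq_integral_Iio, integral_exp_Iic_zero]
  simp

lemma measurable_sectorWeight {ι : Type*} [Fintype ι] (σ : Fin (Fintype.card ι) ≃ ι) :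
    Measurable (sectorWeight σ) := by
  unfold sectorWeight
  refine Measurable.ite ?_ (by fun_prop) measurable_const
  have : {ρ : ι → ℝ | (∀ α, ρ α < 0) ∧ StrictMono (ρ ∘ σ)}
      = (⋂ α, {ρ | ρ α < 0}) ∩ ⋂ i, ⋂ j, ⋂ (_ : i < j), {ρ | ρ (σ i) < ρ (σ j)} := by
    ext ρ; simp [StrictMono]
  rw [this]
  refine (MeasurableSet.iInter fun α => measurableSet_lt (by fun_prop) measurable_const).inter ?_
  exact MeasurableSet.iInter fun i => MeasurableSet.iInter fun j => MeasurableSet.iInter fun _ =>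
    measurableSet_lt (by fun_prop) (by fun_prop)

lemma integrable_sectorWeight {ι : Type*} [Fintype ι] (σ : Fin (Fintype.card ι) ≃ ι) :
    Integrable (sectorWeight σ) := by
  refine integrable_prod_indicator_exp.mono (measurable_sectorWeight σ).aestronglyMeasurable
    (Eventually.of_forall fun ρ => ?_)
  unfold sectorWeight
  split_ifs with h
  · refine le_of_eq ?_
    congr 1
    exact Finset.prod_congr rfl fun α _ => by simp [h.1 α]
  · rw [norm_zero]; exact norm_nonneg _

lemma integral_sectorWeight {ι : Type*} [Fintype ι] (σ : Fin (Fintype.card ι) ≃ ι) :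
    ∫ ρ, sectorWeight σ ρ = ((Fintype.card ι).factorial : ℝ)⁻¹ := by
  have h1 : ∀ σ : Fin (Fintype.card ι) ≃ ι, ∫ ρ, sectorWeight σ ρ
      = ∫ y : Fin (Fintype.card ι) → ℝ, if (∀ k, y k < 0) ∧ StrictMono y
        then ∏ k, Real.exp (y k) else 0 := by
    intro σ
    rw [← (volume_measurePreserving_piCongrLeft (fun _ : ι => ℝ) σ).integral_comp'
      (g := sectorWeight σ)]
    refine integral_congr_ae (Eventually.of_forall fun y => ?_)
    have e : ∀ k, MeasurableEquiv.piCongrLeft (fun _ : ι => ℝ) σ y (σ k) = y k := fun k => by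
      simp [MeasurableEquiv.coe_piCongrLeft]
    simp only [sectorWeight]
    have e2 : (MeasurableEquiv.piCongrLeft (fun _ : ι => ℝ) σ y) ∘ σ = y := funext e
    rw [e2, ← Equiv.prod_comp σ]
    simp only [e, ← σ.forall_congr_right (q := fun α =>
      MeasurableEquiv.piCongrLeft (fun _ : ι => ℝ) σ y α < 0)]
  have h2 : ∑ σ : Fin (Fintype.card ι) ≃ ι, ∫ ρ, sectorWeight σ ρ = 1 := by
    rw [← integral_finsetSum _ fun σ _ => integrable_sectorWeight σ,
      ← integral_prod_indicator_exp (ι := ι)]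
    refine integral_congr_ae ?_
    filter_upwards [ae_injective] with ρ hρ using sum_sectorWeight hρ
  have h3 : ∀ τ, ∫ ρ, sectorWeight τ ρ = ∫ ρ, sectorWeight σ ρ := fun τ => by rw [h1, h1]
  simp only [h3, Finset.sum_const, nsmul_eq_mul, Finset.card_univ] at h2
  rw [Fintype.card_equiv (Fintype.equivFin ι).symm, Fintype.card_fin]  at h2
  exact eq_inv_of_mul_eq_one_right h2

lemma exists_strict_argmax_of_sector {ι κ : Type*} [Fintype ι] {a : κ → ι → ℕ}
    (ha : ∀ i, ∃ α, a i α ≠ 0) (σ : Fin (Fintype.card ι) ≃ ι) :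
    ∃ m : κ → ι, (∀ i, a i (m i) ≠ 0) ∧ ∀ ρ : ι → ℝ, StrictMono (ρ ∘ σ) →
      ∀ i α, a i α ≠ 0 → α ≠ m i → ρ α < ρ (m i) := by
  have : ∀ i, ∃ β, a i β ≠ 0 ∧ ∀ α, a i α ≠ 0 → σ.symm α ≤ σ.symm β := by
    intro i
    obtain ⟨α, hα⟩ := ha i
    obtain ⟨β, hβ, hm⟩ := Finset.exists_max_image (Finset.univ.filter fun α => a i α ≠ 0) σ.symm
      ⟨α, by simpa using hα⟩
    exact ⟨β, by simpa using hβ, fun γ hγ => hm γ (by simpa using hγ)⟩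
  choose m hm hmax using this
  refine ⟨m, hm, fun ρ hρ i α hα hne => ?_⟩
  have hlt : σ.symm α < σ.symm (m i) := lt_of_le_of_ne (hmax i α hα) (by simpa using hne)
  simpa using hρ hlt

lemma tendsto_expForm_mul_exp_neg {ι κ : Type*} [Fintype ι] {a : κ → ι → ℕ} {i : κ} {β : ι}
    {ρ : ι → ℝ} (h : ∀ α, a i α ≠ 0 → α ≠ β → ρ α < ρ β) :
    Tendsto (fun t : ℝ => expForm a i (t • ρ) * Real.exp (-(t * ρ β))) atTop (𝓝 (a i β : ℝ)) := by
  have h1 : ∀ α, Tendsto (fun t : ℝ => (a i α : ℝ) * Real.exp (t * (ρ α - ρ β))) atTop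
      (𝓝 (if α = β then (a i β : ℝ) else 0)) := by
    intro α
    by_cases hαβ : α = β
    · subst hαβ; simp
    · rw [if_neg hαβ]
      by_cases h0 : a i α = 0
      · simp [h0]
      · have h2 : ρ α - ρ β < 0 := sub_neg.2 (h α h0 hαβ)
        have h3 := (Real.tendsto_exp_atBot.comp (tendsto_id.atTop_mul_const_of_neg h2)).const_mul
          (a i α : ℝ)
        simpa using h3
  have h2 := tendsto_finsetSum Finset.univ fun α _ => h1 α
  simp only [Finset.sum_ite_eq', Finset.mem_univ, if_true] at h2
  refine h2.congr fun t => ?_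
  rw [expForm, Finset.sum_mul]
  refine Finset.sum_congr rfl fun α _ => ?_
  rw [mul_assoc, ← Real.exp_add]
  congr 2
  simp only [Pi.smul_apply, smul_eq_mul]
  ring

lemma tendsto_exp_div_prod_expForm {ι κ : Type*} [Fintype ι] [Fintype κ] {a : κ → ι → ℕ}
    {m : κ → ι} (hm : ∀ i, a i (m i) ≠ 0) {ρ : ι → ℝ}
    (hρ : ∀ i α, a i α ≠ 0 → α ≠ m i → ρ α < ρ (m i)) (q : κ → ℕ) (C : ℝ) :
    (C - ∑ i, (q i : ℝ) * ρ (m i) = 0 →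
      Tendsto (fun t : ℝ => Real.exp (t * C) / ∏ i, expForm a i (t • ρ) ^ q i) atTop
        (𝓝 (∏ i, ((a i (m i) : ℝ) ^ q i)⁻¹))) ∧
    (C - ∑ i, (q i : ℝ) * ρ (m i) < 0 →
      Tendsto (fun t : ℝ => Real.exp (t * C) / ∏ i, expForm a i (t • ρ) ^ q i) atTop (𝓝 0)) := by
  have h1 := tendsto_finsetProd Finset.univ fun i (_ : i ∈ Finset.univ) =>
    ((tendsto_expForm_mul_exp_neg (hρ i)).pow (q i)).inv₀
      (pow_ne_zero _ (by exact_mod_cast hm i))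
  have h2 : ∀ t : ℝ, Real.exp (t * C) / ∏ i, expForm a i (t • ρ) ^ q i
      = Real.exp (t * (C - ∑ i, (q i : ℝ) * ρ (m i)))
        * ∏ i, ((expForm a i (t • ρ) * Real.exp (-(t * ρ (m i)))) ^ q i)⁻¹ := by
    intro t
    have h3 : ∏ i, ((expForm a i (t • ρ) * Real.exp (-(t * ρ (m i)))) ^ q i)⁻¹
        = (∏ i, expForm a i (t • ρ) ^ q i)⁻¹
          * Real.exp (t * ∑ i, (q i : ℝ) * ρ (m i)) := by
      rw [Finset.mul_sum, Real.exp_sum, ← Finset.prod_inv_distrib, ← Finset.prod_mul_distrib]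
      refine Finset.prod_congr rfl fun i _ => ?_
      rw [mul_pow, mul_inv, ← Real.exp_nat_mul, ← Real.exp_neg]
      congr 2
      ring
    rw [h3, mul_sub, Real.exp_sub]
    field_simp
  simp only [h2]
  constructor
  · intro h0
    simpa [h0] using h1
  · intro h0
    have h3 := (Real.tendsto_exp_atBot.comp (tendsto_id.atTop_mul_const_of_neg h0)).mul h1
    simpa using h3

lemma mellinIntegrand_rescale {ι κ : Type*} [Fintype ι] [Fintype κ] (a : κ → ι → ℕ)
    (p : ι → ℕ) (q : κ → ℕ) (g : κ → ℝ → ℝ) (l : ℕ) {k : ℝ} (hk : k ≠ 0) (ρ : ι → ℝ) :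
    mellinIntegrand a p q g (-(l : ℂ) + k) (k⁻¹ • ρ)
      = (((∏ α, Real.exp (ρ α)) * (Real.exp (k⁻¹ * ∑ α, ((p α : ℝ) - l) * ρ α)
          / ∏ i, expForm a i (k⁻¹ • ρ) ^ q i) * ∏ i, g i (expForm a i (k⁻¹ • ρ)) : ℝ) : ℂ) := by
  unfold mellinIntegrand
  rw [Finset.prod_div_distrib]
  have h : ∑ α, (-(l : ℂ) + k + p α) * ((k⁻¹ • ρ) α : ℝ)
      = ((∑ α, ρ α + k⁻¹ * ∑ α, ((p α : ℝ) - l) * ρ α : ℝ) : ℂ) := by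
    rw [Finset.mul_sum, ← Finset.sum_add_distrib]
    push_cast
    refine Finset.sum_congr rfl fun α _ => ?_
    have : (k : ℂ) ≠ 0 := by exact_mod_cast hk
    simp only [Pi.smul_apply, smul_eq_mul]
    push_cast
    field_simp
    ring
  rw [h, ← Complex.ofReal_exp, Real.exp_add, Real.exp_sum, ← Complex.ofReal_mul]
  congr 1
  ring

lemma exp_mul_sub_exp_le {δ k : ℝ} (hδ : 0 < δ) (hk : 0 < k) (hk1 : k ≤ 1) (ρ : ℝ) :
    Real.exp (ρ - δ * Real.exp (k⁻¹ * ρ)) ≤ Real.exp δ * Real.exp (1 * ρ - δ * Real.exp ρ) := by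
  rw [← Real.exp_add, Real.exp_le_exp]
  rcases le_total ρ 0 with h | h
  · have h1 : Real.exp ρ ≤ 1 := Real.exp_le_one_iff.2 h
    have := Real.exp_pos (k⁻¹ * ρ)
    nlinarith [mul_pos hδ this]
  · have h1 : ρ ≤ k⁻¹ * ρ := le_mul_of_one_le_left h ((one_le_inv₀ hk).2 hk1)
    have := Real.exp_le_exp.2 h1
    nlinarith

lemma tendsto_prod_of_pos {ι : Type*} [Fintype ι] {δ : ℝ} (hδ : 0 < δ) {ρ : ι → ℝ} {β : ι}
    (hβ : 0 < ρ β) :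
    Tendsto (fun k : ℝ => ∏ α, Real.exp (ρ α - δ * Real.exp (k⁻¹ * ρ α))) (𝓝[>] 0) (𝓝 0) := by
  have h1 : Tendsto (fun k : ℝ => Real.exp (ρ β - δ * Real.exp (k⁻¹ * ρ β))
      * ∏ α ∈ Finset.univ.erase β, Real.exp (ρ α)) (𝓝[>] 0) (𝓝 0) := by
    have h2 : Tendsto (fun k : ℝ => ρ β - δ * Real.exp (k⁻¹ * ρ β)) (𝓝[>] 0) atBot := by
      refine tendsto_atBot_add_const_left _ _ (tendsto_neg_atTop_atBot.comp ?_)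
      exact (Real.tendsto_exp_atTop.comp
        (tendsto_inv_nhdsGT_zero.atTop_mul_const hβ)).const_mul_atTop hδ
    simpa using (Real.tendsto_exp_atBot.comp h2).mul_const _
  refine squeeze_zero (fun k => Finset.prod_nonneg fun α _ => (Real.exp_pos _).le) (fun k => ?_) h1
  rw [← Finset.mul_prod_erase _ _ (Finset.mem_univ β)]
  refine mul_le_mul_of_nonneg_left ?_ (Real.exp_pos _).le
  refine Finset.prod_le_prod (fun α _ => (Real.exp_pos _).le) fun α _ => ?_
  rw [Real.exp_le_exp]
  have := Real.exp_pos (k⁻¹ * ρ α)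
  nlinarith [mul_pos hδ this]

lemma tendsto_expForm_zero {ι κ : Type*} [Fintype ι] (a : κ → ι → ℕ) (i : κ)
    {ρ : ι → ℝ} (hρ : ∀ α, ρ α < 0) :
    Tendsto (fun t : ℝ => expForm a i (t • ρ)) atTop (𝓝 0) := by
  unfold expForm
  have : Tendsto (fun t : ℝ => ∑ α, (a i α : ℝ) * Real.exp ((t • ρ) α)) atTop
      (𝓝 (∑ α : ι, (a i α : ℝ) * 0)) := by
    refine tendsto_finsetSum _ fun α _ => Tendsto.const_mul _ ?_
    exact Real.tendsto_exp_atBot.comp (tendsto_id.atTop_mul_const_of_neg (hρ α))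
  simpa using this

/-- The rescaled integrand of a Mellin form converges, on each sector of vectors with prescribed
ordering, to a rational constant. -/
lemma exists_sector_limit {ι κ : Type*} [Fintype ι] [Fintype κ] {a : κ → ι → ℕ}
    (ha : ∀ i, ∃ α, a i α ≠ 0) {l : ℕ} {p : ι → ℕ} {q : κ → ℕ}
    (hadm : Admissible a (fun α => p α - (l : ℝ)) q) (σ : Fin (Fintype.card ι) ≃ ι) :
    ∃ w : ℚ, (w ≠ 0 → ∑ α, p α = Fintype.card ι * l + ∑ i, q i) ∧
      ∀ᵐ ρ : ι → ℝ, StrictMono (ρ ∘ σ) → (∀ α, ρ α < 0) →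
        Tendsto (fun t : ℝ => Real.exp (t * ∑ α, ((p α : ℝ) - l) * ρ α)
          / ∏ i, expForm a i (t • ρ) ^ q i) atTop (𝓝 (w : ℝ)) := by
  obtain ⟨m, hm, hmax⟩ := exists_strict_argmax_of_sector ha σ
  set e : ι → ℝ := fun α => ((p α : ℝ) - l) - ∑ i, if m i = α then (q i : ℝ) else 0 with he
  have hE : ∀ ρ : ι → ℝ, ∑ α, e α * ρ α
      = ∑ α, ((p α : ℝ) - l) * ρ α - ∑ i, (q i : ℝ) * ρ (m i) := by
    intro ρ
    simp only [he, sub_mul _ (Finset.sum _ _), Finset.sum_sub_distrib, Finset.sum_mul]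
    congr 1
    rw [Finset.sum_comm]
    refine Finset.sum_congr rfl fun i _ => ?_
    simp [ite_mul]
  by_cases h0 : e = 0
  · refine ⟨∏ i, ((a i (m i) : ℚ) ^ q i)⁻¹, fun _ => ?_, Eventually.of_forall fun ρ hρ _ => ?_⟩
    · have := hE 1
      simp only [h0, Pi.zero_apply, Finset.sum_const_zero, Pi.one_apply, mul_one,
        Finset.sum_sub_distrib, Finset.sum_const, Finset.card_univ, nsmul_eq_mul] at this
      have h1 : ((∑ α, p α : ℕ) : ℝ) = ((Fintype.card ι * l + ∑ i, q i : ℕ) : ℝ) := by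
        push_cast; linarith
      exact_mod_cast h1
    · have := (tendsto_exp_div_prod_expForm hm (hmax ρ hρ) q (∑ α, ((p α : ℝ) - l) * ρ α)).1
        (by rw [← hE, h0]; simp)
      push_cast
      exact this
  · refine ⟨0, fun h => absurd rfl h, ?_⟩
    filter_upwards [ae_sum_mul_ne_zero h0] with ρ hne hρ hneg
    have hle := hadm.sum_sub_selection_le hm (τ := ρ) (M := 0) (fun i α hα => ?_)
      (fun α => (hneg α).le)
    · rw [mul_zero, ← hE] at hle
      rw [Rat.cast_zero]
      exact (tendsto_exp_div_prod_expForm hm (hmax ρ hρ) q _).2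
        (by rw [← hE]; exact lt_of_le_of_ne hle hne)
    · rcases eq_or_ne α (m i) with rfl | hαm
      · exact le_rfl
      · exact (hmax ρ hρ i α hα hαm).le

lemma tendsto_mellinForm {ι κ : Type*} [Fintype ι] [Fintype κ] [Nonempty ι] {a : κ → ι → ℕ}
    (ha : ∀ i, ∃ α, a i α ≠ 0) (ha' : ∀ α, ∃ i, a i α ≠ 0) {l : ℕ} {p : ι → ℕ} {q : κ → ℕ}
    (hadm : Admissible a (fun α => p α - (l : ℝ)) q) :
    ∃ w : ℚ, (w ≠ 0 → ∑ α, p α = Fintype.card ι * l + ∑ i, q i) ∧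
      ∀ g : κ → ℝ → ℝ, (∀ i, Continuous (g i)) → (∀ i, ExpDecay (g i)) →
        Tendsto (fun k : ℝ => (k : ℂ) ^ Fintype.card ι * mellinForm a p q g (-(l : ℂ) + k))
          (𝓝[>] 0) (𝓝 ((w : ℂ) * ((∏ i, g i 0 : ℝ) : ℂ))) := by
  choose w hw0 hw using fun σ => exists_sector_limit ha hadm σ
  refine ⟨∑ σ, w σ * ((Fintype.card ι).factorial : ℚ)⁻¹, fun hne => ?_, fun g hgc hg => ?_⟩
  · obtain ⟨σ, _, hσ⟩ := Finset.exists_ne_zero_of_sum_ne_zero hne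
    exact hw0 σ (left_ne_zero_of_mul hσ)
  obtain ⟨K, δ, hK, hδ, hbound⟩ := norm_mellinIntegrand_le ha ha' hadm hg
  have hbound' : ∀ k : ℝ, 0 < k → ∀ ρ : ι → ℝ, ‖mellinIntegrand a p q g (-(l : ℂ) + k) (k⁻¹ • ρ)‖
      ≤ K * ∏ α, Real.exp (ρ α - δ * Real.exp (k⁻¹ * ρ α)) := by
    intro k hk ρ
    refine (hbound _ _).trans (le_of_eq ?_)
    congr 1
    refine Finset.prod_congr rfl fun α _ => ?_
    simp only [add_re, neg_re, natCast_re, ofReal_re, Pi.smul_apply, smul_eq_mul]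
    congr 2
    field_simp
    ring
  have hlim : Tendsto (fun k : ℝ => ∫ ρ, mellinIntegrand a p q g (-(l : ℂ) + k) (k⁻¹ • ρ))
      (𝓝[>] 0) (𝓝 (∫ ρ, (((∏ i, g i 0) * ∑ σ, (w σ : ℝ) * sectorWeight σ ρ : ℝ) : ℂ))) := by
    refine tendsto_integral_filter_of_dominated_convergence
      (fun ρ => K * ∏ α, (Real.exp δ * Real.exp (1 * ρ α - δ * Real.exp (ρ α)))) ?_ ?_ ?_ ?_
    · exact Eventually.of_forall fun k => ((continuous_mellinIntegrand ha p q hgc _).comp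
        (continuous_const_smul k⁻¹)).aestronglyMeasurable
    · have : ∀ᶠ k : ℝ in 𝓝[>] 0, k ≤ 1 :=
        nhdsWithin_le_nhds (eventually_le_nhds (by norm_num))
      filter_upwards [this, self_mem_nhdsWithin] with k hk1 hk
      refine Eventually.of_forall fun ρ => (hbound' k hk ρ).trans ?_
      refine mul_le_mul_of_nonneg_left ?_ hK
      exact Finset.prod_le_prod (fun α _ => (Real.exp_pos _).le) fun α _ =>
        exp_mul_sub_exp_le hδ hk hk1 _
    · simp only [Finset.prod_mul_distrib]
      exact ((integrable_prod_exp_sub_exp one_pos hδ).const_mul _).const_mul _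
    · filter_upwards [ae_apply_ne_zero, ae_injective, ae_all_iff.2 hw] with ρ hne hinj hwρ
      obtain ⟨σ, hσ, hu⟩ := existsUnique_strictMono_comp hinj
      have hsum : ∑ σ, (w σ : ℝ) * sectorWeight σ ρ = w σ * sectorWeight σ ρ := by
        refine Finset.sum_eq_single σ (fun τ _ hτ => ?_) (by simp)
        have : ¬ StrictMono (ρ ∘ τ) := fun h => hτ (hu τ h)
        simp [sectorWeight, this]
      rw [hsum]
      by_cases hneg : ∀ α, ρ α < 0
      · have h1 : sectorWeight σ ρ = ∏ α, Real.exp (ρ α) := by simp [sectorWeight, hneg, hσ]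
        have h2 := (hwρ σ hσ hneg).comp (tendsto_inv_nhdsGT_zero (𝕜 := ℝ))
        have h3 : Tendsto (fun k : ℝ => ∏ i, g i (expForm a i (k⁻¹ • ρ))) (𝓝[>] 0)
            (𝓝 (∏ i, g i 0)) := tendsto_finsetProd _ fun i _ =>
          ((hgc i).tendsto 0).comp ((tendsto_expForm_zero a i hneg).comp tendsto_inv_nhdsGT_zero)
        have h4 := (Complex.continuous_ofReal.tendsto _).comp
          (((tendsto_const_nhds (x := ∏ α, Real.exp (ρ α))).mul h2).mul h3)
        rw [h1, show (∏ i, g i 0) * ((w σ : ℝ) * ∏ α, Real.exp (ρ α))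
          = (∏ α, Real.exp (ρ α)) * w σ * ∏ i, g i 0 by ring]
        refine h4.congr' ?_
        filter_upwards [self_mem_nhdsWithin] with k hk
        exact (mellinIntegrand_rescale a p q g l (ne_of_gt hk) ρ).symm
      · have h1 : sectorWeight σ ρ = 0 := by simp only [sectorWeight, hneg, false_and, if_false]
        push Not at hneg
        obtain ⟨β, hβ⟩ := hneg
        have hβ' : 0 < ρ β := lt_of_le_of_ne hβ (hne β).symm
        rw [h1]
        simp only [mul_zero, Complex.ofReal_zero]
        refine squeeze_zero_norm' ?_ (by simpa using (tendsto_prod_of_pos hδ hβ').const_mul K)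
        filter_upwards [self_mem_nhdsWithin] with k hk using hbound' k hk ρ
  have hval : ∫ ρ, (((∏ i, g i 0) * ∑ σ, (w σ : ℝ) * sectorWeight σ ρ : ℝ) : ℂ)
      = (((∑ σ, w σ * ((Fintype.card ι).factorial : ℚ)⁻¹ : ℚ) : ℂ)
        * ((∏ i, g i 0 : ℝ) : ℂ)) := by
    rw [integral_complex_ofReal, integral_const_mul, integral_finsetSum _ fun σ _ =>
      (integrable_sectorWeight σ).const_mul _]
    simp only [integral_const_mul, integral_sectorWeight]
    push_cast
    ring
  rw [hval] at hlim
  refine hlim.congr' ?_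
  filter_upwards [self_mem_nhdsWithin] with k hk
  rw [Measure.integral_comp_inv_smul, Module.finrank_fintype_fun_eq_card, mellinForm,
    abs_of_pos (pow_pos hk _)]
  simp

/-- The rational span of the products of Taylor derivatives at `0` of total order `K`. -/
def taylorSpan (κ : Type*) [Fintype κ] (K : ℕ) : Submodule ℚ ((κ → ℝ → ℝ) → ℝ) :=
  Submodule.span ℚ ((fun (k : κ → ℕ) h => ∏ i, iteratedDeriv (k i) (h i) 0) ''
    {k | ∑ i, k i = K})

/-- The family `f h` of functions on a right half-plane becomes holomorphic on `Re s > -l` after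
multiplication by a rational polynomial, and has at `-l` a leading coefficient of order `n` which
is a rational polynomial in the Taylor coefficients of `h` at `0`. -/
def HasTaylorLimit {κ : Type*} [Fintype κ] (l n K : ℕ) (f : (κ → ℝ → ℝ) → ℂ → ℂ) : Prop :=
  ∃ D : Polynomial ℚ, Polynomial.aeval (-(l : ℂ)) D ≠ 0 ∧ ∃ L ∈ taylorSpan κ K,
    ∀ h : κ → ℝ → ℝ, (∀ i, RapidlyDecaying (h i)) → ∃ H : ℂ → ℂ,
      DifferentiableOn ℂ H {s | -(l : ℝ) < s.re} ∧
      (∃ σ : ℝ, ∀ s : ℂ, σ < s.re → H s = Polynomial.aeval s D * f h s) ∧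
      Tendsto (fun k : ℝ => (k : ℂ) ^ n * H (-(l : ℂ) + k)) (𝓝[>] 0)
        (𝓝 (Polynomial.aeval (-(l : ℂ)) D * (L h : ℂ)))

lemma tendsto_neg_add_ofReal (l : ℕ) :
    Tendsto (fun k : ℝ => -(l : ℂ) + k) (𝓝[>] 0) (𝓝 (-(l : ℂ))) := by
  have h : Continuous fun k : ℝ => -(l : ℂ) + k := by fun_prop
  have := h.tendsto 0
  simp only [Complex.ofReal_zero, add_zero] at this
  exact this.mono_left nhdsWithin_le_nhds

lemma tendsto_aeval (l : ℕ) (D : Polynomial ℚ) :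
    Tendsto (fun k : ℝ => Polynomial.aeval (-(l : ℂ) + k) D) (𝓝[>] 0)
      (𝓝 (Polynomial.aeval (-(l : ℂ)) D)) :=
  (D.continuous_aeval.tendsto _).comp (tendsto_neg_add_ofReal l)

namespace HasTaylorLimit

variable {κ : Type*} [Fintype κ] {l n K : ℕ} {f g : (κ → ℝ → ℝ) → ℂ → ℂ}

lemma zero : HasTaylorLimit (κ := κ) l n K fun _ _ => 0 :=
  ⟨1, by simp, 0, Submodule.zero_mem _, fun _ _ => ⟨fun _ => 0, differentiableOn_const _,
    ⟨0, fun _ _ => by simp⟩, by simp⟩⟩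

lemma add (hf : HasTaylorLimit l n K f) (hg : HasTaylorLimit l n K g) :
    HasTaylorLimit l n K fun h s => f h s + g h s := by
  obtain ⟨D₁, hD₁, L₁, hL₁, H₁⟩ := hf
  obtain ⟨D₂, hD₂, L₂, hL₂, H₂⟩ := hg
  refine ⟨D₁ * D₂, by rw [map_mul]; exact mul_ne_zero hD₁ hD₂, L₁ + L₂,
    Submodule.add_mem _ hL₁ hL₂, fun h hh => ?_⟩
  obtain ⟨H₁, hd₁, ⟨σ₁, he₁⟩, ht₁⟩ := H₁ h hh
  obtain ⟨H₂, hd₂, ⟨σ₂, he₂⟩, ht₂⟩ := H₂ h hh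
  refine ⟨fun s => Polynomial.aeval s D₂ * H₁ s + Polynomial.aeval s D₁ * H₂ s,
    (D₂.differentiable_aeval.differentiableOn.mul hd₁).add
      (D₁.differentiable_aeval.differentiableOn.mul hd₂), ⟨max σ₁ σ₂, fun s hs => ?_⟩, ?_⟩
  · simp only
    rw [he₁ s ((le_max_left _ _).trans_lt hs), he₂ s ((le_max_right _ _).trans_lt hs), map_mul]
    ring
  · have := ((tendsto_aeval l D₂).mul ht₁).add ((tendsto_aeval l D₁).mul ht₂)
    rw [map_mul, Pi.add_apply, Complex.ofReal_add]
    convert! this using 2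
    · ring
    · ring

lemma const_mul (c : ℚ) (hf : HasTaylorLimit l n K f) :
    HasTaylorLimit l n K fun h s => (c : ℂ) * f h s := by
  obtain ⟨D, hD, L, hL, H⟩ := hf
  refine ⟨D, hD, c • L, Submodule.smul_mem _ _ hL, fun h hh => ?_⟩
  obtain ⟨H, hd, ⟨σ, he⟩, ht⟩ := H h hh
  refine ⟨fun s => c * H s, hd.const_mul _, ⟨σ, fun s hs => ?_⟩, ?_⟩
  · simp only
    rw [he s hs]; ring
  · convert! ht.const_mul (c : ℂ) using 2
    · ring
    · rw [Pi.smul_apply, Rat.smul_def]; push_cast; ring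

lemma sum {T : Type*} (S : Finset T) {f : T → (κ → ℝ → ℝ) → ℂ → ℂ}
    (hf : ∀ t ∈ S, HasTaylorLimit l n K (f t)) :
    HasTaylorLimit l n K fun h s => ∑ t ∈ S, f t h s := by
  induction S using Finset.induction_on with
  | empty => simpa using zero
  | insert t S ht ih =>
    simp only [Finset.sum_insert ht]
    exact (hf t (by simp)).add (ih fun t ht => hf t (by simp [ht]))

lemma of_mul (c : Polynomial ℚ) (hc : c.eval (-(l : ℚ)) ≠ 0) (hg : HasTaylorLimit l n K g)
    (hfg : ∀ h : κ → ℝ → ℝ, (∀ i, RapidlyDecaying (h i)) → ∃ σ : ℝ, ∀ s : ℂ, σ < s.re →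
      Polynomial.aeval s c * f h s = g h s) : HasTaylorLimit l n K f := by
  obtain ⟨D, hD, L, hL, H⟩ := hg
  have hca : Polynomial.aeval (-(l : ℂ)) c = ((c.eval (-(l : ℚ)) : ℚ) : ℂ) := by
    have := Polynomial.aeval_algebraMap_apply ℂ (-(l : ℚ)) c
    simpa using this
  have hc' : ((c.eval (-(l : ℚ)) : ℚ) : ℂ) ≠ 0 := by exact_mod_cast hc
  refine ⟨D * c, ?_, (c.eval (-(l : ℚ)))⁻¹ • L, Submodule.smul_mem _ _ hL, fun h hh => ?_⟩
  · rw [map_mul, hca]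
    exact mul_ne_zero hD hc'
  obtain ⟨H, hd, ⟨σ, he⟩, ht⟩ := H h hh
  obtain ⟨σ', hσ'⟩ := hfg h hh
  refine ⟨H, hd, ⟨max σ σ', fun s hs => ?_⟩, ?_⟩
  · rw [he s ((le_max_left _ _).trans_lt hs), ← hσ' s ((le_max_right _ _).trans_lt hs), map_mul]
    ring
  · convert! ht using 2
    rw [map_mul, hca, Pi.smul_apply, Rat.smul_def]
    push_cast
    field_simp

end HasTaylorLimit

/-- The integer defect of the subset `A` in the admissibility condition at `s = -l`. -/
def excess {ι κ : Type*} [Fintype κ] (a : κ → ι → ℕ) (l : ℕ) (p : ι → ℕ) (q : κ → ℕ)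
    (A : Finset ι) : ℤ :=
  ∑ α ∈ A, ((p α : ℤ) - l) - ∑ i, if SupportedIn a A i then (q i : ℤ) else 0

lemma admissible_of_excess_nonneg {ι κ : Type*} [Fintype κ] {a : κ → ι → ℕ} {l : ℕ} {p : ι → ℕ}
    {q : κ → ℕ} (h : ∀ A, 0 ≤ excess a l p q A) : Admissible a (fun α => p α - (l : ℝ)) q := by
  intro A
  have h1 : ((∑ i, if SupportedIn a A i then (q i : ℤ) else 0 : ℤ) : ℝ)
      ≤ ((∑ α ∈ A, ((p α : ℤ) - l) : ℤ) : ℝ) := by exact_mod_cast sub_nonneg.1 (h A)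
  push_cast at h1
  exact h1

lemma excess_add_single_left {ι κ : Type*} [Fintype κ] (a : κ → ι → ℕ) (l : ℕ) (p : ι → ℕ)
    (q : κ → ℕ) (A : Finset ι) (β : ι) :
    excess a l (p + Pi.single β 1) q A = excess a l p q A + if β ∈ A then 1 else 0 := by
  have : (if β ∈ A then (1 : ℤ) else 0) = ∑ α ∈ A, (((Pi.single β 1 : ι → ℕ) α : ℕ) : ℤ) := by
    simp [Pi.single_apply]
  unfold excess
  rw [this, sub_add_eq_add_sub, ← Finset.sum_add_distrib]
  congr 1
  refine Finset.sum_congr rfl fun α _ => ?_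
  push_cast [Pi.add_apply]
  ring

lemma excess_add_single_right {ι κ : Type*} [Fintype κ] (a : κ → ι → ℕ) (l : ℕ) (p : ι → ℕ)
    (q : κ → ℕ) (A : Finset ι) (k : κ) :
    excess a l p (q + Pi.single k 1) A
      = excess a l p q A - if SupportedIn a A k then 1 else 0 := by
  have : (if SupportedIn a A k then (1 : ℤ) else 0)
      = ∑ i, if SupportedIn a A i then (((Pi.single k 1 : κ → ℕ) i : ℕ) : ℤ) else 0 := by
    rw [Finset.sum_eq_single k (fun i _ hi => by simp [hi]) (by simp)]
    simp
  unfold excess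
  rw [this, sub_sub, ← Finset.sum_add_distrib]
  congr 1
  refine Finset.sum_congr rfl fun i _ => ?_
  split_ifs <;> simp

/-- The total failure of admissibility at `s = -l`. -/
def deficit {ι κ : Type*} [Fintype ι] [Fintype κ] (a : κ → ι → ℕ) (l : ℕ) (p : ι → ℕ)
    (q : κ → ℕ) : ℕ :=
  ∑ A : Finset ι, (-excess a l p q A).toNat

lemma deficit_lt {ι κ : Type*} [Fintype ι] [Fintype κ] {a : κ → ι → ℕ} {l : ℕ} {p p' : ι → ℕ}
    {q q' : κ → ℕ} (hle : ∀ B, excess a l p q B ≤ excess a l p' q' B) {A : Finset ι}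
    (hA : excess a l p q A < 0) (hlt : excess a l p q A < excess a l p' q' A) :
    deficit a l p' q' < deficit a l p q := by
  refine Finset.sum_lt_sum (fun B _ => ?_) ⟨A, Finset.mem_univ A, ?_⟩
  · have := hle B; omega
  · omega

lemma admissible_neg_sum {ι κ : Type*} [Fintype κ] {a : κ → ι → ℕ} (ha : ∀ i, ∃ α, a i α ≠ 0)
    (p : ι → ℕ) (q : κ → ℕ) : Admissible a (fun α => p α - (-((∑ i, q i : ℕ) : ℝ))) q := by
  intro A
  rcases A.eq_empty_or_nonempty with rfl | ⟨β, hβ⟩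
  · refine le_of_eq ?_
    rw [Finset.sum_empty]
    refine Finset.sum_eq_zero fun i _ => if_neg fun h => ?_
    obtain ⟨α, hα⟩ := ha i
    simpa using h α hα
  · calc ∑ i, (if SupportedIn a A i then (q i : ℝ) else 0) ≤ ∑ i, (q i : ℝ) :=
          Finset.sum_le_sum fun i _ => by split_ifs <;> simp
      _ ≤ (p β : ℝ) - (-((∑ i, q i : ℕ) : ℝ)) := by push_cast; simp
      _ ≤ _ := Finset.single_le_sum (f := fun α => (p α : ℝ) - (-((∑ i, q i : ℕ) : ℝ)))
          (fun α _ => by rw [sub_neg_eq_add]; positivity) hβ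

lemma hasTaylorLimit_mellinForm {ι κ : Type*} [Fintype ι] [Fintype κ] [Nonempty ι]
    {a : κ → ι → ℕ} (ha : ∀ i, ∃ α, a i α ≠ 0) (ha' : ∀ α, ∃ i, a i α ≠ 0) {l K : ℕ}
    (p : ι → ℕ) (q : κ → ℕ) (j : κ → ℕ)
    (hdeg : K + ∑ α, p α = Fintype.card ι * l + ∑ i, q i + ∑ i, j i) :
    HasTaylorLimit l (Fintype.card ι) K fun h s => mellinForm a p q (jet h j) s := by
  induction hN : deficit a l p q using Nat.strong_induction_on generalizing p q j with
  | _ N ih =>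
  by_cases hadm : ∀ A, 0 ≤ excess a l p q A
  · have hadm' := admissible_of_excess_nonneg hadm
    obtain ⟨w, hw, ht⟩ := tendsto_mellinForm ha ha' hadm'
    refine ⟨1, by simp, w • fun h => ∏ i, iteratedDeriv (j i) (h i) 0, ?_, fun h hh =>
      ⟨mellinForm a p q (jet h j), ?_, ⟨0, fun s _ => by simp⟩, ?_⟩⟩
    · by_cases h0 : w = 0
      · rw [h0, zero_smul]; exact Submodule.zero_mem _
      · refine Submodule.smul_mem _ _ (Submodule.subset_span ⟨j, ?_, rfl⟩)
        have := hw h0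
        simp only [Set.mem_ofPred_eq]
        omega
    · exact differentiableOn_mellinForm ha ha' hadm' (RapidlyDecaying.continuous_jet hh j)
        fun i => (hh i).2 (j i)
    · have := ht (jet h j) (RapidlyDecaying.continuous_jet hh j) fun i => (hh i).2 (j i)
      convert! this using 2
      simp [Rat.smul_def, jet]
  push Not at hadm
  obtain ⟨A, hA⟩ := hadm
  have hsum1 : ∀ α : ι, ∑ β, (p + Pi.single α 1 : ι → ℕ) β = ∑ β, p β + 1 := fun α => by
    simp [Finset.sum_add_distrib]
  have hsum2 : ∀ (x : κ → ℕ) (i : κ), ∑ k, (x + Pi.single i 1 : κ → ℕ) k = ∑ k, x k + 1 :=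
    fun x i => by simp [Finset.sum_add_distrib]
  have hmain : HasTaylorLimit l (Fintype.card ι) K fun (h : κ → ℝ → ℝ) s => ∑ i, ∑ α ∈ A,
      ((((if SupportedIn a A i then 0 else (q i * a i α : ℚ)) : ℚ) : ℂ) * mellinForm a
          (p + Pi.single α 1) (q + Pi.single i 1) (jet h j) s
        + ((-(a i α : ℚ) : ℚ) : ℂ) * mellinForm a (p + Pi.single α 1) q
          (jet h (j + Pi.single i 1)) s) := by
    refine HasTaylorLimit.sum _ fun i _ => HasTaylorLimit.sum _ fun α hα =>
      HasTaylorLimit.add ?_ (HasTaylorLimit.const_mul _ ?_)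
    · by_cases hz : SupportedIn a A i ∨ a i α = 0
      · have : ((if SupportedIn a A i then 0 else (q i * a i α : ℚ)) : ℚ) = 0 := by
          rcases hz with hz | hz <;> simp [hz]
        simp only [this, Rat.cast_zero, zero_mul]
        exact HasTaylorLimit.zero
      · push Not at hz
        refine HasTaylorLimit.const_mul _ (ih _ ?_ _ _ _ ?_ rfl)
        · rw [← hN]
          refine deficit_lt (fun B => ?_) hA ?_
          · rw [excess_add_single_right, excess_add_single_left]
            by_cases hB : SupportedIn a B i
            · simp [hB, hB α hz.2]
            · simp only [hB, if_false]; split_ifs <;> omega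
          · rw [excess_add_single_right, excess_add_single_left]
            simp [hα, hz.1]
        · rw [hsum1, hsum2]; omega
    · refine ih _ ?_ _ _ _ ?_ rfl
      · rw [← hN]
        refine deficit_lt (fun B => ?_) hA ?_
        · rw [excess_add_single_left]; split_ifs <;> omega
        · rw [excess_add_single_left]; simp [hα]
      · rw [hsum1, hsum2]; omega
  set c : Polynomial ℚ := ∑ α ∈ A, (Polynomial.X + Polynomial.C (p α : ℚ))
    - Polynomial.C (∑ i, if SupportedIn a A i then (q i : ℚ) else 0) with hc
  refine HasTaylorLimit.of_mul c ?_ hmain fun h hh => ⟨((∑ i, q i : ℕ) : ℝ), fun s hs => ?_⟩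
  · have : c.eval (-(l : ℚ)) = (excess a l p q A : ℚ) := by
      rw [hc, excess, Polynomial.eval_sub, Polynomial.eval_finsetSum]
      push_cast
      simp only [Polynomial.eval_add, Polynomial.eval_X, Polynomial.eval_C]
      congr 1
      exact Finset.sum_congr rfl fun α _ => by ring
    rw [this]
    exact_mod_cast hA.ne
  · have hrec := mellinForm_recursion ha ha' (admissible_neg_sum ha p q) hh j (s := s)
      (by rwa [neg_neg]) A
    have e1 : Polynomial.aeval s c
        = ∑ α ∈ A, (s + p α) - ∑ i, if SupportedIn a A i then (q i : ℂ) else 0 := by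
      rw [hc]
      simp [apply_ite]
    rw [e1, hrec]
    refine Finset.sum_congr rfl fun i _ => Finset.sum_congr rfl fun α _ => ?_
    push_cast
    split_ifs <;> simp [sub_eq_add_neg]

lemma tendsto_mul_Gamma_neg_nat (l : ℕ) :
    Tendsto (fun k : ℝ => (k : ℂ) * Complex.Gamma (-(l : ℂ) + k)) (𝓝[>] 0)
      (𝓝 ((-1) ^ l / (l.factorial : ℂ))) := by
  induction l with
  | zero =>
    have h : Tendsto (fun k : ℝ => (k : ℂ)) (𝓝[>] 0) (𝓝[≠] 0) := by
      refine tendsto_nhdsWithin_of_tendsto_nhds_of_eventually_within _ ?_ ?_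
      · exact (Complex.continuous_ofReal.tendsto' 0 0 Complex.ofReal_zero).mono_left
          nhdsWithin_le_nhds
      · filter_upwards [self_mem_nhdsWithin] with k hk
        simpa using (ne_of_gt hk : k ≠ 0)
    simpa [Function.comp_def] using Complex.tendsto_self_mul_Gamma_nhds_zero.comp h
  | succ l ih =>
    have h1 : Tendsto (fun k : ℝ => -((l + 1 : ℕ) : ℂ) + k) (𝓝[>] 0) (𝓝 (-((l + 1 : ℕ) : ℂ))) :=
      tendsto_neg_add_ofReal (l + 1)
    have hne : -((l + 1 : ℕ) : ℂ) ≠ 0 := neg_ne_zero.2 (by exact_mod_cast Nat.succ_ne_zero l)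
    have h2 := ih.div h1 hne
    have e : (-1) ^ l / (l.factorial : ℂ) / -((l + 1 : ℕ) : ℂ)
        = (-1) ^ (l + 1) / ((l + 1).factorial : ℂ) := by
      rw [Nat.factorial_succ, div_neg, div_div, pow_succ]
      push_cast
      rw [mul_comm (l.factorial : ℂ)]
      ring
    rw [e] at h2
    refine h2.congr' ?_
    filter_upwards [h1.eventually_ne hne] with k hk
    simp only [Pi.div_apply]
    have := Complex.Gamma_add_one _ hk
    rw [show -((l + 1 : ℕ) : ℂ) + k + 1 = -(l : ℂ) + k by push_cast; ring] at this
    rw [this]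
    field_simp

lemma eq_zero_of_meromorphicOn {U : Set ℂ} (hU : IsConnected U) {M : ℂ → ℂ}
    (hM : MeromorphicOn M U) {z w : ℂ} (hz : z ∈ U) (hw : w ∈ U) (h0 : ∀ᶠ s in 𝓝 z, M s = 0)
    (hc : ContinuousAt M w) : M w = 0 := by
  have hw' : meromorphicOrderAt M w = ⊤ := by
    by_contra hne
    have := (hM.exists_meromorphicOrderAt_ne_top_iff_forall hU).1 ⟨⟨w, hw⟩, hne⟩ ⟨z, hz⟩
    exact this (meromorphicOrderAt_eq_top_iff.2 (h0.filter_mono nhdsWithin_le_nhds))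
  have h1 := meromorphicOrderAt_eq_top_iff.1 hw'
  exact tendsto_nhds_unique (hc.tendsto.mono_left nhdsWithin_le_nhds)
    (tendsto_const_nhds.congr' (h1.mono fun s hs => hs.symm))

lemma HasTaylorLimit.exists_value {κ : Type*} [Fintype κ] {l n K : ℕ}
    {f : (κ → ℝ → ℝ) → ℂ → ℂ} (hf : HasTaylorLimit l n K f) :
    ∃ L ∈ taylorSpan κ K, ∀ h : κ → ℝ → ℝ, (∀ i, RapidlyDecaying (h i)) →
      ∀ F : ℂ → ℂ, MeromorphicOn F Set.univ → AnalyticAt ℂ F (-(l : ℂ)) →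
        (∃ σ : ℝ, ∀ s : ℂ, σ < s.re → F s * Complex.Gamma s ^ n = f h s) →
        F (-(l : ℂ)) * ((-1) ^ l / (l.factorial : ℂ)) ^ n = (L h : ℂ) := by
  obtain ⟨D, hD, L, hL, hH⟩ := hf
  refine ⟨L, hL, fun h hh F hF hFa ⟨σ, hσ⟩ => ?_⟩
  obtain ⟨H, hd, ⟨σ', he⟩, ht⟩ := hH h hh
  set U : Set ℂ := {s | -(l : ℝ) < s.re} with hU
  have hUo : IsOpen U := isOpen_lt continuous_const Complex.continuous_re
  have hHa : ∀ s ∈ U, AnalyticAt ℂ H s := fun s hs => hd.analyticAt (hUo.mem_nhds hs)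
  have hGa : ∀ s, AnalyticAt ℂ (fun s => (Complex.Gamma s)⁻¹) s := fun s =>
    (Complex.differentiable_one_div_Gamma.analyticAt s)
  have hDa : ∀ s, AnalyticAt ℂ (fun s : ℂ => Polynomial.aeval s D) s := fun s =>
    (D.differentiable_aeval.analyticAt s)
  set M : ℂ → ℂ := fun s => Polynomial.aeval s D * F s - H s * (Complex.Gamma s)⁻¹ ^ n with hM
  have hMm : MeromorphicOn M U := fun s hs =>
    ((hDa s).meromorphicAt.mul (hF s trivial)).sub
      ((hHa s hs).meromorphicAt.mul ((hGa s).pow n).meromorphicAt)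
  set x : ℝ := max 0 (max σ σ') + 1 with hx
  have hx0 : 0 < x := by positivity
  have hxU : (x : ℂ) ∈ U := by
    simp only [hU, Set.mem_ofPred_eq, Complex.ofReal_re]
    have : (0 : ℝ) ≤ l := Nat.cast_nonneg l
    linarith
  have hUc : IsConnected U := (convex_halfSpace_re_gt (-(l : ℝ))).isConnected
    ⟨_, hxU⟩
  have hM0 : ∀ᶠ s in 𝓝 (x : ℂ), M s = 0 := by
    have : {s : ℂ | max 0 (max σ σ') < s.re} ∈ 𝓝 (x : ℂ) :=
      (isOpen_lt continuous_const Complex.continuous_re).mem_nhds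
        (by simp only [Set.mem_ofPred_eq, Complex.ofReal_re, hx]; exact lt_add_one _)
    filter_upwards [this] with s hs
    have h0 : 0 < s.re := (le_max_left _ _).trans_lt hs
    have h1 : σ < s.re := ((le_max_left _ _).trans (le_max_right _ _)).trans_lt hs
    have h2 : σ' < s.re := ((le_max_right _ _).trans (le_max_right _ _)).trans_lt hs
    have h3 : Complex.Gamma s ≠ 0 := Complex.Gamma_ne_zero_of_re_pos h0
    simp only [hM]
    rw [he s h2, ← hσ s h1, inv_pow, mul_assoc, mul_inv_cancel_right₀ (pow_ne_zero n h3), sub_self]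
  have hev : ∀ᶠ k : ℝ in 𝓝[>] 0, Polynomial.aeval (-(l : ℂ) + k) D * F (-(l : ℂ) + k)
      = (k : ℂ) ^ n * H (-(l : ℂ) + k) * (((k : ℂ) * Complex.Gamma (-(l : ℂ) + k))⁻¹) ^ n := by
    filter_upwards [(tendsto_neg_add_ofReal l).eventually hFa.eventually_analyticAt,
      self_mem_nhdsWithin] with k hk hk0
    have hkU : -(l : ℂ) + k ∈ U := by simpa [hU] using hk0
    have h0 := eq_zero_of_meromorphicOn hUc hMm hxU hkU hM0
      (((hDa _).mul hk).sub ((hHa _ hkU).mul ((hGa _).pow n))).continuousAt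
    have hk1 : (k : ℂ) ≠ 0 := by exact_mod_cast (ne_of_gt hk0 : k ≠ 0)
    rw [sub_eq_zero.1 h0, mul_inv, mul_pow, inv_pow (k : ℂ)]
    field_simp
  have hc : ((-1) ^ l / (l.factorial : ℂ)) ≠ 0 :=
    div_ne_zero (pow_ne_zero _ (by norm_num)) (by exact_mod_cast l.factorial_ne_zero)
  have hlim1 := (tendsto_aeval l D).mul (hFa.continuousAt.tendsto.comp (tendsto_neg_add_ofReal l))
  have hlim2 := (ht.mul (((tendsto_mul_Gamma_neg_nat l).inv₀ hc).pow n)).congr'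
    (hev.mono fun k hk => hk.symm)
  have := tendsto_nhds_unique hlim1 hlim2
  rw [mul_assoc] at this
  have h3 := mul_left_cancel₀ hD this
  rw [h3, mul_assoc, ← mul_pow, inv_mul_cancel₀ hc, one_pow, mul_one]

/-- Smooth functions all of whose derivatives grow at most linearly on the positive half-line. -/
def LinearGrowth (B : ℝ → ℝ) : Prop :=
  ContDiff ℝ ∞ B ∧ ∀ j, ∃ C, ∀ u, 0 < u → |iteratedDeriv j B u| ≤ C * (1 + u)

lemma iteratedDeriv_exp_mul {B : ℝ → ℝ} (hB : ContDiff ℝ ∞ B) (c : ℝ) (n : ℕ) (u : ℝ) :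
    iteratedDeriv n (fun u => Real.exp (c * u) * B u) u = ∑ i ∈ Finset.range (n + 1),
      n.choose i * (c ^ i * Real.exp (c * u)) * iteratedDeriv (n - i) B u := by
  have h1 : ContDiff ℝ n fun u => Real.exp (c * u) := by fun_prop
  have := iteratedDeriv_mul (x := u) h1.contDiffAt
    (hB.of_le (by exact_mod_cast le_top) : ContDiff ℝ n B).contDiffAt
  simpa [Pi.mul_def, iteratedDeriv_exp_const_mul] using this

lemma exp_neg_mul_one_add_le {x u : ℝ} (hx : 0 < x) (hu : 0 < u) :
    Real.exp (-x * u) * (1 + u) ≤ (1 + 2 / x) * Real.exp (-(x / 2) * u) := by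
  have h1 : Real.exp (-x * u) = Real.exp (-(x / 2) * u) * Real.exp (-(x / 2) * u) := by
    rw [← Real.exp_add]; congr 1; ring
  have h2 : Real.exp (-(x / 2) * u) * (1 + u) ≤ 1 + 2 / x := by
    have h3 : Real.exp (-(x / 2) * u) ≤ 1 := Real.exp_le_one_iff.2 (by nlinarith)
    have h4 : Real.exp (-(x / 2) * u) * u ≤ 2 / x := by
      have h5 := Real.add_one_le_exp (x / 2 * u)
      rw [show -(x / 2) * u = -(x / 2 * u) by ring, Real.exp_neg, inv_mul_le_iff₀ (Real.exp_pos _)]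
      have h6 : x / 2 * u * (2 / x) = u := by field_simp
      nlinarith [div_pos two_pos hx]
    nlinarith
  rw [h1, mul_assoc, mul_comm (1 + 2 / x)]
  exact mul_le_mul_of_nonneg_left h2 (Real.exp_pos _).le

lemma LinearGrowth.rapidlyDecaying {B : ℝ → ℝ} (hB : LinearGrowth B) {x : ℝ} (hx : 0 < x) :
    RapidlyDecaying fun u => Real.exp (-x * u) * B u := by
  refine ⟨(Real.contDiff_exp.comp (contDiff_const.mul contDiff_id)).mul hB.1, fun n => ?_⟩
  choose C hC using hB.2
  refine ⟨∑ i ∈ Finset.range (n + 1), n.choose i * x ^ i * (C (n - i) * (1 + 2 / x)), x / 2,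
    by positivity, fun u hu => ?_⟩
  rw [iteratedDeriv_exp_mul hB.1, Finset.sum_mul]
  refine (Finset.abs_sum_le_sum_abs _ _).trans (Finset.sum_le_sum fun i _ => ?_)
  have h0 : 0 ≤ C (n - i) := by
    have := (abs_nonneg _).trans (hC (n - i) u hu)
    exact nonneg_of_mul_nonneg_left this (by linarith)
  rw [abs_mul, abs_mul, abs_mul, abs_pow, abs_neg, abs_of_pos hx, abs_of_pos (Real.exp_pos _),
    abs_of_nonneg (Nat.cast_nonneg _)]
  calc _ ≤ n.choose i * (x ^ i * Real.exp (-x * u)) * (C (n - i) * (1 + u)) :=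
        mul_le_mul_of_nonneg_left (hC _ u hu) (by positivity)
    _ = n.choose i * x ^ i * C (n - i) * (Real.exp (-x * u) * (1 + u)) := by ring
    _ ≤ n.choose i * x ^ i * C (n - i) * ((1 + 2 / x) * Real.exp (-(x / 2) * u)) :=
        mul_le_mul_of_nonneg_left (exp_neg_mul_one_add_le hx hu) (by positivity)
    _ = _ := by ring

lemma linearGrowth_one : LinearGrowth fun _ => 1 := by
  refine ⟨contDiff_const, fun j => ⟨1, fun u hu => ?_⟩⟩
  rw [iteratedDeriv_const]
  split_ifs <;> simp <;> linarith

lemma linearGrowth_id : LinearGrowth id := by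
  refine ⟨contDiff_id, fun j => ⟨1, fun u hu => ?_⟩⟩
  rw [iteratedDeriv_id]
  split_ifs
  · rw [abs_of_pos hu]; linarith
  · simp; linarith
  · simp; linarith

/-- The smooth extension of `u / (1 - exp (-u))`. -/
def toddFun (u : ℝ) : ℝ := (dslope (fun v : ℝ => 1 - Real.exp (-v)) 0 u)⁻¹

lemma one_sub_exp_neg_ne_zero {u : ℝ} (hu : u ≠ 0) : 1 - Real.exp (-u) ≠ 0 := by
  intro h
  have : Real.exp (-u) = 1 := by linarith
  rw [Real.exp_eq_one_iff] at this
  exact hu (by linarith)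

lemma deriv_one_sub_exp_neg : deriv (fun v : ℝ => 1 - Real.exp (-v)) 0 = 1 := by
  have h : HasDerivAt (fun v : ℝ => 1 - Real.exp (-v)) 1 0 := by
    have := ((hasDerivAt_id (0 : ℝ)).neg.exp).const_sub 1
    simpa using this
  exact h.deriv

lemma toddFun_of_ne {u : ℝ} (hu : u ≠ 0) : toddFun u = u / (1 - Real.exp (-u)) := by
  rw [toddFun, dslope_of_ne _ hu, slope_def_field]
  simp

lemma toddFun_zero : toddFun 0 = 1 := by
  rw [toddFun, dslope_same, deriv_one_sub_exp_neg, inv_one]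

lemma toddFun_mul (u : ℝ) : toddFun u * (1 - Real.exp (-u)) = u := by
  rcases eq_or_ne u 0 with rfl | hu
  · simp
  · rw [toddFun_of_ne hu, div_mul_cancel₀ _ (one_sub_exp_neg_ne_zero hu)]

lemma contDiff_toddFun : ContDiff ℝ ∞ toddFun := by
  rw [contDiff_iff_contDiffAt]
  intro u
  rcases eq_or_ne u 0 with rfl | hu
  · have h1 : AnalyticAt ℝ (fun v : ℝ => 1 - Real.exp (-v)) 0 :=
      analyticAt_const.sub (analyticAt_id.neg.rexp)
    obtain ⟨P, hP⟩ := h1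
    have h2 : AnalyticAt ℝ (dslope (fun v : ℝ => 1 - Real.exp (-v)) 0) 0 :=
      ⟨_, hP.has_fpower_series_dslope_fslope⟩
    exact h2.contDiffAt.inv (by rw [dslope_same, deriv_one_sub_exp_neg]; exact one_ne_zero)
  · have h1 : ContDiffAt ℝ ∞ (fun u : ℝ => u / (1 - Real.exp (-u))) u :=
      contDiffAt_id.div (by fun_prop) (one_sub_exp_neg_ne_zero hu)
    refine h1.congr_of_eventuallyEq ?_
    filter_upwards [isOpen_ne.mem_nhds hu] with v hv using toddFun_of_ne hv

lemma iteratedDeriv_one_sub_exp_neg (m : ℕ) (u : ℝ) :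
    iteratedDeriv m (fun v : ℝ => 1 - Real.exp (-v)) u
      = (if m = 0 then 1 else 0) - (-1) ^ m * Real.exp (-u) := by
  have h1 : (fun v : ℝ => Real.exp (-v)) = fun v => Real.exp (-1 * v) := by simp
  rw [iteratedDeriv_fun_sub contDiffAt_const (by fun_prop), iteratedDeriv_const, h1,
    iteratedDeriv_exp_const_mul]
  simp

lemma toddFun_recursion (n : ℕ) (u : ℝ) :
    iteratedDeriv n toddFun u * (1 - Real.exp (-u)) = iteratedDeriv n id u
      + ∑ i ∈ Finset.range n, n.choose i * iteratedDeriv i toddFun u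
          * ((-1) ^ (n - i) * Real.exp (-u)) := by
  have h1 : toddFun * (fun v : ℝ => 1 - Real.exp (-v)) = id := funext toddFun_mul
  have h2 : ContDiff ℝ n fun v : ℝ => 1 - Real.exp (-v) := by fun_prop
  have := iteratedDeriv_mul (x := u) (n := n)
    (contDiff_toddFun.of_le (by exact_mod_cast le_top) : ContDiff ℝ n toddFun).contDiffAt
    h2.contDiffAt
  rw [h1, Finset.sum_range_succ] at this
  rw [this, Nat.sub_self, iteratedDeriv_one_sub_exp_neg, add_right_comm, ← Finset.sum_add_distrib,
    Finset.sum_eq_zero]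
  · simp
  · intro i hi
    have : n - i ≠ 0 := by have := Finset.mem_range.1 hi; omega
    rw [iteratedDeriv_one_sub_exp_neg, if_neg this]
    ring

lemma linearGrowth_toddFun : LinearGrowth toddFun := by
  refine ⟨contDiff_toddFun, fun n => ?_⟩
  induction n using Nat.strong_induction_on with
  | _ n ih =>
  obtain ⟨C0, hC0⟩ := linearGrowth_id.2 n
  choose! C hC using ih
  have hcont : Continuous (iteratedDeriv n toddFun) :=
    contDiff_toddFun.continuous_iteratedDeriv n (by exact_mod_cast le_top)
  obtain ⟨C1, hC1⟩ := isCompact_Icc.exists_bound_of_continuousOn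
    (hcont.continuousOn (s := Set.Icc 0 1))
  set c : ℝ := 1 - Real.exp (-1) with hc
  have hc0 : 0 < c := by rw [hc, sub_pos, Real.exp_lt_one_iff]; norm_num
  set C2 : ℝ := C0 + ∑ i ∈ Finset.range n, n.choose i * C i with hC2
  refine ⟨max C1 (C2 / c), fun u hu => ?_⟩
  rcases le_total u 1 with h1 | h1
  · have h2 := hC1 u ⟨hu.le, h1⟩
    rw [Real.norm_eq_abs] at h2
    have h3 : 0 ≤ C1 := (abs_nonneg _).trans h2
    calc _ ≤ C1 := h2
      _ ≤ C1 * (1 + u) := by nlinarith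
      _ ≤ _ := mul_le_mul_of_nonneg_right (le_max_left _ _) (by linarith)
  · have he : Real.exp (-u) ≤ 1 := Real.exp_le_one_iff.2 (by linarith)
    have h2 : c ≤ 1 - Real.exp (-u) := by
      have := Real.exp_le_exp.2 (neg_le_neg h1); linarith
    have h3 : |iteratedDeriv n toddFun u * (1 - Real.exp (-u))| ≤ C2 * (1 + u) := by
      rw [toddFun_recursion, hC2, add_mul, Finset.sum_mul]
      refine (abs_add_le _ _).trans (add_le_add (hC0 u hu) ?_)
      refine (Finset.abs_sum_le_sum_abs _ _).trans (Finset.sum_le_sum fun i hi => ?_)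
      have h4 := hC i (Finset.mem_range.1 hi) u hu
      rw [abs_mul, abs_mul, abs_mul, abs_pow, abs_neg, abs_one, one_pow, one_mul,
        abs_of_pos (Real.exp_pos _), abs_of_nonneg (Nat.cast_nonneg _)]
      calc _ ≤ n.choose i * |iteratedDeriv i toddFun u| * 1 :=
            mul_le_mul_of_nonneg_left he (by positivity)
        _ ≤ _ := by
            rw [mul_one, mul_assoc]
            exact mul_le_mul_of_nonneg_left h4 (Nat.cast_nonneg _)
    rw [abs_mul, abs_of_pos (hc0.trans_le h2)] at h3
    have h5 : |iteratedDeriv n toddFun u| ≤ C2 / c * (1 + u) := by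
      rw [div_mul_eq_mul_div, le_div_iff₀ hc0]
      exact (mul_le_mul_of_nonneg_left h2 (abs_nonneg _)).trans h3
    exact h5.trans (mul_le_mul_of_nonneg_right (le_max_right _ _) (by linarith))

lemma iteratedDeriv_toddFun_zero (n : ℕ) : ∃ b : ℚ, iteratedDeriv n toddFun 0 = b := by
  induction n using Nat.strong_induction_on with
  | _ n ih =>
  choose! b hb using ih
  have h := toddFun_recursion (n + 1) 0
  rw [Finset.sum_range_succ, iteratedDeriv_id] at h
  simp only [neg_zero, Real.exp_zero, sub_self, mul_zero, mul_one, Nat.choose_succ_self_right,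
    Nat.add_sub_cancel_left, pow_one, Nat.add_eq_zero_iff, one_ne_zero, and_false, if_false] at h
  have hn : ((n + 1 : ℕ) : ℝ) ≠ 0 := by exact_mod_cast Nat.succ_ne_zero n
  refine ⟨((if n + 1 = 1 then 1 else 0)
    + ∑ i ∈ Finset.range n, (n + 1).choose i * b i * (-1) ^ (n + 1 - i)) / ((n + 1 : ℕ) : ℚ), ?_⟩
  rw [eq_comm, Rat.cast_div, Rat.cast_natCast, div_eq_iff hn]
  have hs : ∑ i ∈ Finset.range n, ((n + 1).choose i : ℝ) * iteratedDeriv i toddFun 0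
      * (-1) ^ (n + 1 - i)
      = ∑ i ∈ Finset.range n, ((n + 1).choose i : ℝ) * b i * (-1) ^ (n + 1 - i) :=
    Finset.sum_congr rfl fun i hi => by rw [hb i (Finset.mem_range.1 hi)]
  rw [hs] at h
  push_cast at h ⊢
  split_ifs at h ⊢ <;> push_cast <;> linarith

namespace RootSystemData

variable {r : ℕ} {E : Type*} [NormedAddCommGroup E] [InnerProductSpace ℝ E]
  (S : RootSystemData r E)

lemma inner_self_pos {α : E} (hα : α ∈ S.roots) : 0 < ⟪α, α⟫ :=
  real_inner_self_pos.2 (S.ne_zero α hα)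

lemma inner_weight_simple (i j : Fin r) :
    ⟪S.weight i, S.simple j⟫ = if i = j then ⟪S.simple j, S.simple j⟫ / 2 else 0 := by
  have h := S.weight_dual i j
  have h0 := (S.inner_self_pos (S.pos_subset (S.simple_mem_pos j))).ne'
  rw [inner_smul_right] at h
  split_ifs at h ⊢ with hij
  · field_simp at h
    linarith
  · have := mul_eq_zero.1 h
    rcases this with h1 | h1
    · exact absurd h1 (div_ne_zero two_ne_zero h0)
    · exact h1

lemma inner_weight_sum (i : Fin r) (c : Fin r → ℝ) :
    ⟪S.weight i, ∑ j, c j • S.simple j⟫ = c i * (⟪S.simple i, S.simple i⟫ / 2) := by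
  rw [inner_sum]
  simp [inner_smul_right, inner_weight_simple]

lemma coeff_ext {c d : Fin r → ℝ} (h : ∑ j, c j • S.simple j = ∑ j, d j • S.simple j) : c = d := by
  ext i
  have h1 := congrArg (fun v => ⟪S.weight i, v⟫) h
  simp only [inner_weight_sum] at h1
  have h0 := (S.inner_self_pos (S.pos_subset (S.simple_mem_pos i))).ne'
  exact mul_right_cancel₀ (div_ne_zero h0 two_ne_zero) h1

lemma pairing_eq (i : Fin r) (α : E) : S.pairing i α = 2 / ⟪α, α⟫ * ⟪S.weight i, α⟫ := by
  rw [pairing, inner_smul_right]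

lemma pairing_simple (i j : Fin r) : S.pairing i (S.simple j) = if i = j then 1 else 0 :=
  S.weight_dual i j

lemma pairing_sum (i : Fin r) {α : E} {c : Fin r → ℝ} (h : α = ∑ j, c j • S.simple j) :
    S.pairing i α = c i * (⟪S.simple i, S.simple i⟫ / ⟪α, α⟫) := by
  rw [pairing_eq]
  conv_lhs => rw [show ⟪S.weight i, α⟫ = c i * (⟪S.simple i, S.simple i⟫ / 2) by
    rw [h, inner_weight_sum]]
  ring

lemma exists_int_pairing (N : ℕ) : ∀ α ∈ S.pos, ∀ c : Fin r → ℕ,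
    α = ∑ j, (c j : ℝ) • S.simple j → ∑ j, c j = N → ∀ i, ∃ z : ℤ, S.pairing i α = z := by
  induction N using Nat.strong_induction_on with
  | _ N ih =>
  intro α hα c hc hN i
  have hαr := S.pos_subset hα
  have hα0 := S.inner_self_pos hαr
  obtain ⟨j, -, hj⟩ : ∃ j ∈ Finset.univ, 0 < (c j : ℝ) * ⟪α, S.simple j⟫ := by
    apply Finset.exists_lt_of_sum_lt
    rw [Finset.sum_const_zero]
    calc 0 < ⟪α, α⟫ := hα0
      _ = ∑ j, (c j : ℝ) * ⟪α, S.simple j⟫ := by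
        conv_lhs => rw [show ⟪α, α⟫ = ⟪α, ∑ j, (c j : ℝ) • S.simple j⟫ by rw [← hc]]
        simp [inner_sum, inner_smul_right]
  have hip : 0 < ⟪α, S.simple j⟫ := pos_of_mul_pos_right hj (Nat.cast_nonneg _)
  have hjr := S.pos_subset (S.simple_mem_pos j)
  have hj0 := S.inner_self_pos hjr
  obtain ⟨z, hz⟩ := S.crystallographic _ hjr _ hαr
  have hβ := S.reflection_mem _ hjr _ hαr
  have hzpos : 0 < z := by
    have : (0 : ℝ) < z := by rw [← hz]; positivity
    exact_mod_cast this
  rw [hz] at hβ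
  have hsingle : ∑ k, (if k = j then (z : ℝ) else 0) • S.simple k = (z : ℝ) • S.simple j := by
    simp [ite_smul]
  have hβc : α - (z : ℝ) • S.simple j
      = ∑ k, ((c k : ℝ) - if k = j then (z : ℝ) else 0) • S.simple k := by
    simp only [sub_smul, Finset.sum_sub_distrib]
    rw [hsingle, ← hc]
  rcases S.mem_pos_or _ hβ with hp | hp
  · obtain ⟨d, hd⟩ := S.simple_base _ hp
    have hcd := S.coeff_ext (hβc.symm.trans hd)
    have hsum : (∑ k, d k : ℕ) < N := by
      have h1 : ((∑ k, d k : ℕ) : ℝ) = (N : ℝ) - z := by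
        rw [← hN]
        push_cast
        simp only [← congrFun hcd, Finset.sum_sub_distrib]
        simp
      have h2 : (0 : ℝ) < z := by exact_mod_cast hzpos
      have : ((∑ k, d k : ℕ) : ℝ) < N := by linarith
      exact_mod_cast this
    obtain ⟨y, hy⟩ := ih _ hsum _ hp d hd rfl i
    obtain ⟨x, hx⟩ := S.crystallographic _ hαr _ hjr
    have hnorm : ⟪α - (z : ℝ) • S.simple j, α - (z : ℝ) • S.simple j⟫ = ⟪α, α⟫ := by
      rw [real_inner_sub_sub_self, real_inner_smul_left, real_inner_smul_right,
        real_inner_smul_right]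
      have : (z : ℝ) * ⟪S.simple j, S.simple j⟫ = 2 * ⟪α, S.simple j⟫ := by
        rw [← hz]; field_simp
      linear_combination (z : ℝ) * this
    refine ⟨y + (if i = j then x else 0), ?_⟩
    rw [pairing_eq] at hy ⊢
    rw [hnorm, inner_sub_right, inner_smul_right, inner_weight_simple] at hy
    push_cast
    rw [← hy]
    split_ifs with hij
    · rw [← hx, ← hz, real_inner_comm α (S.simple j)]
      field_simp
      ring
    · simp
  · obtain ⟨d, hd⟩ := S.simple_base _ hp
    have hcd : (fun k => -((c k : ℝ) - if k = j then (z : ℝ) else 0)) = fun k => (d k : ℝ) := by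
      apply S.coeff_ext
      simp only [neg_smul, Finset.sum_neg_distrib]
      rw [← hβc, hd]
    have hz0 : ∀ k, k ≠ j → c k = 0 := by
      intro k hk
      have h1 := congrFun hcd k
      simp only [hk, if_false, sub_zero] at h1
      have h2 : (0 : ℝ) ≤ c k := Nat.cast_nonneg _
      have h3 : (0 : ℝ) ≤ d k := Nat.cast_nonneg _
      have : (c k : ℝ) = 0 := by linarith
      exact_mod_cast this
    have hαj : α = (c j : ℝ) • S.simple j := by
      rw [hc]
      exact Finset.sum_eq_single j (fun k _ hk => by simp [hz0 k hk]) (by simp)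
    have hc1 : (c j : ℝ) = 1 := by
      rcases S.reduced _ hjr (c j) (hαj ▸ hαr) with h | h
      · exact h
      · have : (0 : ℝ) ≤ c j := Nat.cast_nonneg _
        linarith
    rw [hαj, hc1, one_smul, pairing_simple]
    exact ⟨if i = j then 1 else 0, by push_cast; rfl⟩

/-- The pairings of the fundamental weights with the positive coroots are natural numbers. -/
lemma exists_nat_pairing {α : E} (hα : α ∈ S.pos) (i : Fin r) : ∃ a : ℕ, S.pairing i α = a := by
  obtain ⟨c, hc⟩ := S.simple_base α hα
  obtain ⟨z, hz⟩ := S.exists_int_pairing _ α hα c hc rfl i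
  have h0 : 0 ≤ z := by
    have : (0 : ℝ) ≤ z := by
      rw [← hz, S.pairing_sum i hc]
      exact mul_nonneg (Nat.cast_nonneg _) (div_nonneg real_inner_self_nonneg
        real_inner_self_nonneg)
    exact_mod_cast this
  obtain ⟨a, rfl⟩ := Int.eq_ofNat_of_zero_le h0
  exact ⟨a, by simpa using hz⟩

lemma exists_pairing_ne_zero {α : E} (hα : α ∈ S.pos) : ∃ i, S.pairing i α ≠ 0 := by
  by_contra! h
  obtain ⟨c, hc⟩ := S.simple_base α hα
  have hα0 := (S.inner_self_pos (S.pos_subset hα)).ne'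
  have : ∀ j, (c j : ℝ) = 0 := by
    intro j
    have h1 := h j
    rw [S.pairing_sum j hc] at h1
    have h0 := (S.inner_self_pos (S.pos_subset (S.simple_mem_pos j))).ne'
    exact (mul_eq_zero.1 h1).resolve_right (div_ne_zero h0 hα0)
  apply S.ne_zero α (S.pos_subset hα)
  rw [hc]
  simp [this]

end RootSystemData

lemma integral_cexp_mul_exp_neg {L : ℝ} (hL : 0 < L) {s : ℂ} (hs : 0 < s.re) :
    ∫ τ : ℝ, Complex.exp (s * τ) * Real.exp (-(L * Real.exp τ)) =
      Complex.Gamma s * (L : ℂ) ^ (-s) := by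
  have h := Complex.integral_cpow_mul_exp_neg_mul_Ioi hs hL
  have h2 := integral_image_eq_integral_abs_deriv_smul (s := Set.univ) (f := Real.exp)
    (f' := Real.exp) MeasurableSet.univ (fun x _ => (Real.hasDerivAt_exp x).hasDerivWithinAt)
    Real.exp_injective.injOn
    (fun t : ℝ => (t : ℂ) ^ (s - 1) * Complex.exp (-((L : ℂ) * t)))
  rw [Set.image_univ, Real.range_exp, h, setIntegral_univ] at h2
  rw [one_div, Complex.inv_cpow _ _ (by rw [Complex.arg_ofReal_of_nonneg hL.le]; exact
    Real.pi_pos.ne), ← Complex.cpow_neg] at h2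
  rw [mul_comm (Complex.Gamma s), h2]
  refine integral_congr_ae (ae_of_all _ fun τ => ?_)
  have h0 : (Real.exp τ : ℂ) ≠ 0 := by exact_mod_cast (Real.exp_pos τ).ne'
  have h1 : ((Real.exp τ : ℝ) : ℂ) ^ (s - 1) = Complex.exp (s * τ) / (Real.exp τ : ℂ) := by
    rw [Complex.cpow_sub _ _ h0, Complex.cpow_one, Complex.cpow_def_of_ne_zero h0,
      ← Complex.ofReal_log (Real.exp_pos τ).le, Real.log_exp, mul_comm s]
  simp only [Real.abs_exp, h1, Complex.real_smul]
  push_cast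
  field_simp

lemma mellinIntegrand_exp_eq_prod {ι κ : Type*} [Fintype ι] [Fintype κ] (a : κ → ι → ℕ)
    (y : κ → ℝ) (s : ℂ) (τ : ι → ℝ) :
    mellinIntegrand a (fun _ => 0) (fun _ => 0) (fun i u => Real.exp (-y i * u)) s τ =
      ∏ α, Complex.exp (s * τ α) * Real.exp (-((∑ i, y i * a i α) * Real.exp (τ α))) := by
  rw [mellinIntegrand, Finset.prod_mul_distrib, ← Complex.exp_sum]
  simp only [Nat.cast_zero, add_zero, pow_zero, div_one]
  congr 1
  rw [← Complex.ofReal_prod, ← Real.exp_sum, ← Real.exp_sum]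
  congr 2
  simp only [expForm, neg_mul, Finset.sum_neg_distrib, Finset.mul_sum, Finset.sum_mul]
  rw [Finset.sum_comm]
  simp only [mul_assoc]

lemma linearForm_pos {ι κ : Type*} [Fintype κ] {a : κ → ι → ℕ} (ha' : ∀ α, ∃ i, a i α ≠ 0)
    {y : κ → ℝ} (hy : ∀ i, 0 < y i) (α : ι) : 0 < ∑ i, y i * a i α := by
  obtain ⟨i, hi⟩ := ha' α
  refine Finset.sum_pos' (fun i _ => mul_nonneg (hy i).le (Nat.cast_nonneg _))
    ⟨i, Finset.mem_univ i, mul_pos (hy i) ?_⟩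
  exact_mod_cast Nat.pos_of_ne_zero hi

/-- The Mellin transform of a product of exponentials is a product of powers of linear forms. -/
lemma mellinForm_exp {ι κ : Type*} [Fintype ι] [Fintype κ] {a : κ → ι → ℕ}
    (ha' : ∀ α, ∃ i, a i α ≠ 0) {y : κ → ℝ} (hy : ∀ i, 0 < y i) {s : ℂ} (hs : 0 < s.re) :
    mellinForm a (fun _ => 0) (fun _ => 0) (fun i u => Real.exp (-y i * u)) s =
      Complex.Gamma s ^ Fintype.card ι * ∏ α, ((∑ i, y i * a i α : ℝ) : ℂ) ^ (-s) := by
  rw [mellinForm]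
  simp only [mellinIntegrand_exp_eq_prod]
  rw [integral_fintype_prod_volume_eq_prod (fun α (t : ℝ) => Complex.exp (s * t) *
    Real.exp (-((∑ i, y i * a i α) * Real.exp t)))]
  simp only [integral_cexp_mul_exp_neg (linearForm_pos ha' hy _) hs, Finset.prod_mul_distrib,
    Finset.prod_const, Finset.card_univ]

lemma hasSum_prod_of_nonneg {r : ℕ} {f : Fin r → ℕ → ℝ} {c : Fin r → ℝ}
    (hf0 : ∀ i m, 0 ≤ f i m) (hf : ∀ i, HasSum (f i) (c i)) :
    HasSum (fun m : Fin r → ℕ => ∏ i, f i (m i)) (∏ i, c i) := by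
  induction r with
  | zero => simp
  | succ r ih =>
    have h1 := ih (f := fun i => f i.succ) (c := fun i => c i.succ) (fun i => hf0 i.succ)
      (fun i => hf i.succ)
    have h0 : 0 ≤ fun m : Fin r → ℕ => ∏ i : Fin r, f i.succ (m i) :=
      fun m => Finset.prod_nonneg fun i _ => hf0 i.succ (m i)
    have hs : Summable fun x : ℕ × (Fin r → ℕ) => f 0 x.1 * ∏ i : Fin r, f i.succ (x.2 i) :=
      Summable.mul_of_nonneg (f := f 0) (g := fun m : Fin r → ℕ => ∏ i : Fin r, f i.succ (m i))
        (hf 0).summable h1.summable (Pi.le_def.2 (hf0 0)) h0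
    have h2 := (hf 0).mul h1 hs
    rw [← (Fin.consEquiv fun _ => ℕ).hasSum_iff, Fin.prod_univ_succ]
    have h3 : (fun m : Fin (r + 1) → ℕ => ∏ i, f i (m i)) ∘ Fin.consEquiv (fun _ => ℕ) =
        fun x : ℕ × (Fin r → ℕ) => f 0 x.1 * ∏ i, f i.succ (x.2 i) := by
      ext ⟨k, m⟩
      simp [Fin.prod_univ_succ, Fin.consEquiv]
    rw [h3]
    exact h2

lemma mellinIntegrand_eq_mul {ι κ : Type*} [Fintype ι] [Fintype κ] (a : κ → ι → ℕ)
    (q : κ → ℕ) (g : κ → ℝ → ℝ) (s : ℂ) (τ : ι → ℝ) :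
    mellinIntegrand a (fun _ => 0) q g s τ = Complex.exp (∑ α, s * τ α) *
      (∏ i, g i (expForm a i τ) / expForm a i τ ^ q i : ℝ) := by
  simp [mellinIntegrand]

lemma norm_mellinIntegrand_of_nonneg {ι κ : Type*} [Fintype ι] [Fintype κ] (a : κ → ι → ℕ)
    (q : κ → ℕ) (g : κ → ℝ → ℝ) (hg : ∀ i u, 0 ≤ g i u) (s : ℂ) (τ : ι → ℝ) :
    ‖mellinIntegrand a (fun _ => 0) q g s τ‖ = Real.exp (∑ α, s.re * τ α) *
      ∏ i, g i (expForm a i τ) / expForm a i τ ^ q i := by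
  have h : ∀ i, 0 ≤ expForm a i τ := fun i =>
    Finset.sum_nonneg fun α _ => mul_nonneg (Nat.cast_nonneg _) (Real.exp_pos _).le
  rw [mellinIntegrand_eq_mul, norm_mul, Complex.norm_exp, Complex.norm_real, Real.norm_of_nonneg
    (Finset.prod_nonneg fun i _ => div_nonneg (hg i _) (pow_nonneg (h i) _))]
  simp

lemma expDecay_exp {x : ℝ} (hx : 0 < x) : ExpDecay fun u => Real.exp (-x * u) :=
  ⟨1, x, hx, fun u _ => by rw [Real.abs_exp, one_mul]⟩

lemma hasSum_exp_toddFun {x u : ℝ} (hu : 0 < u) :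
    HasSum (fun m : ℕ => Real.exp (-(m + x) * u)) (Real.exp (-x * u) * toddFun u / u ^ 1) := by
  have h1 : Real.exp (-u) < 1 := by rw [Real.exp_lt_one_iff]; linarith
  have h := (hasSum_geometric_of_lt_one (Real.exp_pos (-u)).le h1).mul_left (Real.exp (-x * u))
  rw [toddFun_of_ne hu.ne', show Real.exp (-x * u) * (u / (1 - Real.exp (-u))) / u ^ 1 =
    Real.exp (-x * u) * (1 - Real.exp (-u))⁻¹ by field_simp]
  have h2 : (fun m : ℕ => Real.exp (-(m + x) * u)) =
      fun m : ℕ => Real.exp (-x * u) * Real.exp (-u) ^ m := by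
    ext m
    rw [← Real.exp_nat_mul, ← Real.exp_add]
    congr 1
    ring
  rw [h2]
  exact h

lemma toddFun_nonneg (u : ℝ) : 0 ≤ toddFun u := by
  rcases eq_or_ne u 0 with rfl | hu
  · rw [toddFun_zero]; exact zero_le_one
  · rw [toddFun_of_ne hu]
    rcases hu.lt_or_gt with h | h
    · exact div_nonneg_of_nonpos h.le (by
        have : 1 < Real.exp (-u) := Real.one_lt_exp_iff.2 (by linarith)
        linarith)
    · exact div_nonneg h.le (by
        have : Real.exp (-u) < 1 := Real.exp_lt_one_iff.2 (by linarith)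
        linarith)

/-- The lattice sum of the powers of linear forms is the Mellin transform of a product of Todd
functions. -/
lemma tsum_mul_gamma_pow {ι : Type*} [Fintype ι] [Nonempty ι] {r : ℕ} {a : Fin r → ι → ℕ}
    (ha : ∀ i, ∃ α, a i α ≠ 0) (ha' : ∀ α, ∃ i, a i α ≠ 0) {x : Fin r → ℝ} (hx : ∀ i, 0 < x i)
    {s : ℂ} (hs : (r : ℝ) < s.re) :
    (∑' m : Fin r → ℕ, ∏ α, ((∑ i, ((m i : ℝ) + x i) * a i α : ℝ) : ℂ) ^ (-s)) *
      Complex.Gamma s ^ Fintype.card ι =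
    mellinForm a (fun _ => 0) (fun _ => 1) (fun i u => Real.exp (-x i * u) * toddFun u) s := by
  have hs0 : 0 < s.re := (Nat.cast_nonneg r).trans_lt hs
  have hU : ∀ i τ, 0 < expForm a i τ := fun i => expForm_pos (ha i)
  have hd : ∀ i, RapidlyDecaying fun u => Real.exp (-x i * u) * toddFun u := fun i =>
    linearGrowth_toddFun.rapidlyDecaying (hx i)
  have hint : Integrable (mellinIntegrand a (fun _ => 0) (fun _ => 1)
      (fun i u => Real.exp (-x i * u) * toddFun u) s) :=
    integrable_mellinIntegrand ha ha' (admissible_neg_sum ha (fun _ => 0) (fun _ => 1))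
      (fun i => (hd i).1.continuous)
      (fun i => by simpa using (hd i).2 0) (by simpa using hs)
  have hsumR : ∀ τ, HasSum (fun m : Fin r → ℕ => ∏ i, Real.exp (-(m i + x i) * expForm a i τ))
      (∏ i, Real.exp (-x i * expForm a i τ) * toddFun (expForm a i τ) / expForm a i τ ^ 1) :=
    fun τ => hasSum_prod_of_nonneg (f := fun i m => Real.exp (-(m + x i) * expForm a i τ))
      (fun _ _ => (Real.exp_pos _).le) fun i => hasSum_exp_toddFun (hU i τ)
  have hsum : ∀ τ, HasSum (fun m : Fin r → ℕ => mellinIntegrand a (fun _ => 0) (fun _ => 0)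
      (fun i u => Real.exp (-(m i + x i) * u)) s τ)
      (mellinIntegrand a (fun _ => 0) (fun _ => 1)
      (fun i u => Real.exp (-x i * u) * toddFun u) s τ) := by
    intro τ
    simp only [mellinIntegrand_eq_mul, pow_zero, div_one]
    exact (Complex.hasSum_ofReal.2 (hsumR τ)).mul_left _
  have hsumN : ∀ τ, HasSum (fun m : Fin r → ℕ => ‖mellinIntegrand a (fun _ => 0) (fun _ => 0)
      (fun i u => Real.exp (-(m i + x i) * u)) s τ‖)
      ‖mellinIntegrand a (fun _ => 0) (fun _ => 1)
      (fun i u => Real.exp (-x i * u) * toddFun u) s τ‖ := by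
    intro τ
    rw [norm_mellinIntegrand_of_nonneg _ _ _
      (fun i u => mul_nonneg (Real.exp_pos _).le (toddFun_nonneg u))]
    simp only [fun m : Fin r → ℕ => norm_mellinIntegrand_of_nonneg a (fun _ => 0)
      (fun i u => Real.exp (-(m i + x i) * u)) (fun _ _ => (Real.exp_pos _).le), pow_zero, div_one]
    exact (hsumR τ).mul_left _
  have key := hasSum_integral_of_dominated_convergence (μ := volume)
    (fun (m : Fin r → ℕ) τ => ‖mellinIntegrand a (fun _ => 0) (fun _ => 0)
      (fun i u => Real.exp (-(m i + x i) * u)) s τ‖)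
    (fun m => (continuous_mellinIntegrand ha _ _ (fun i => by fun_prop) s).aestronglyMeasurable)
    (fun m => ae_of_all _ fun τ => le_rfl) (ae_of_all _ fun τ => (hsumN τ).summable)
    (by simpa only [(hsumN _).tsum_eq] using hint.norm) (ae_of_all _ hsum)
  change HasSum (fun m : Fin r → ℕ => mellinForm a (fun _ => 0) (fun _ => 0)
      (fun i u => Real.exp (-(m i + x i) * u)) s) (mellinForm _ _ _ _ _) at key
  rw [← key.tsum_eq, ← tsum_mul_right]
  refine tsum_congr fun m => ?_
  rw [mellinForm_exp ha' (y := fun i => m i + x i)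
    (fun i => add_pos_of_nonneg_of_pos (Nat.cast_nonneg _) (hx i)) hs0, mul_comm]

lemma integral_exp_translate_Ioi {x u : ℝ} (hu : 0 < u) :
    ∫ t in Set.Ioi (0 : ℝ), Real.exp (-(t + x) * u) = Real.exp (-x * u) * 1 / u ^ 1 := by
  have h : ∀ t : ℝ, Real.exp (-(t + x) * u) = Real.exp (-x * u) * Real.exp (-u * t) := by
    intro t
    rw [← Real.exp_add]; congr 1; ring
  simp only [h]
  rw [integral_const_mul, integral_exp_mul_Ioi (neg_lt_zero.2 hu)]
  simp
  field_simp

lemma setOf_forall_pos_eq {κ : Type*} :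
    {t : κ → ℝ | ∀ i, 0 < t i} = Set.univ.pi fun _ => Set.Ioi (0 : ℝ) := by
  ext t; simp

lemma integrable_prod_exp_translate {κ : Type*} [Fintype κ] (x : κ → ℝ) {u : κ → ℝ}
    (hu : ∀ i, 0 < u i) :
    Integrable (fun t : κ → ℝ => ∏ i, Real.exp (-(t i + x i) * u i))
      (volume.restrict {t : κ → ℝ | ∀ i, 0 < t i}) := by
  rw [setOf_forall_pos_eq, volume_pi, Measure.restrict_pi_pi]
  refine Integrable.fintype_prod (f := fun i t => Real.exp (-(t + x i) * u i)) fun i => ?_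
  have h : ∀ t : ℝ, Real.exp (-(t + x i) * u i) = Real.exp (-x i * u i) * Real.exp (-u i * t) := by
    intro t
    rw [← Real.exp_add]; congr 1; ring
  simp only [h]
  exact (integrableOn_exp_mul_Ioi (neg_lt_zero.2 (hu i)) 0).const_mul _

lemma integral_prod_exp_translate {κ : Type*} [Fintype κ] (x : κ → ℝ) {u : κ → ℝ}
    (hu : ∀ i, 0 < u i) :
    ∫ t in {t : κ → ℝ | ∀ i, 0 < t i}, ∏ i, Real.exp (-(t i + x i) * u i) =
      ∏ i, Real.exp (-x i * u i) * 1 / u i ^ 1 := by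
  rw [setOf_forall_pos_eq, volume_pi, Measure.restrict_pi_pi,
    integral_fintype_prod_eq_prod (𝕜 := ℝ) (fun i t => Real.exp (-(t + x i) * u i))]
  exact Finset.prod_congr rfl fun i _ => integral_exp_translate_Ioi (hu i)

/-- The integral of the powers of linear forms is the Mellin transform of a product of
exponentials divided by the coordinates. -/
lemma integral_mul_gamma_pow {ι κ : Type*} [Fintype ι] [Nonempty ι] [Fintype κ] {a : κ → ι → ℕ}
    (ha : ∀ i, ∃ α, a i α ≠ 0) (ha' : ∀ α, ∃ i, a i α ≠ 0) {x : κ → ℝ} (hx : ∀ i, 0 < x i)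
    {s : ℂ} (hs : (Fintype.card κ : ℝ) < s.re) :
    (∫ t in {t : κ → ℝ | ∀ i, 0 < t i}, ∏ α, ((∑ i, (t i + x i) * a i α : ℝ) : ℂ) ^ (-s)) *
      Complex.Gamma s ^ Fintype.card ι =
    mellinForm a (fun _ => 0) (fun _ => 1) (fun i u => Real.exp (-x i * u) * 1) s := by
  have hs0 : 0 < s.re := (Nat.cast_nonneg _).trans_lt hs
  have hU : ∀ τ i, 0 < expForm a i τ := fun τ i => expForm_pos (ha i) τ
  have hint : Integrable (mellinIntegrand a (fun _ => 0) (fun _ => 1)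
      (fun i u => Real.exp (-x i * u) * 1) s) :=
    integrable_mellinIntegrand ha ha' (admissible_neg_sum ha (fun _ => 0) (fun _ => 1))
      (fun i => by fun_prop)
      (fun i => by simpa using expDecay_exp (hx i)) (by simpa using hs)
  set T : Set (κ → ℝ) := {t | ∀ i, 0 < t i} with hT
  have hTm : MeasurableSet T := by
    rw [hT, setOf_forall_pos_eq]
    exact MeasurableSet.univ_pi fun _ => measurableSet_Ioi
  set G : (κ → ℝ) → (ι → ℝ) → ℂ := fun t τ => mellinIntegrand a (fun _ => 0) (fun _ => 0)
    (fun i u => Real.exp (-(t i + x i) * u)) s τ with hG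
  have hGc : Continuous (Function.uncurry G) := by
    simp only [hG, mellinIntegrand_eq_mul, pow_zero, div_one, expForm, Function.uncurry_def]
    fun_prop
  have hGn : ∀ t τ, ‖G t τ‖ = Real.exp (∑ α, s.re * τ α) *
      ∏ i, Real.exp (-(t i + x i) * expForm a i τ) := by
    intro t τ
    simp only [hG]
    rw [norm_mellinIntegrand_of_nonneg _ _ _ fun i u => (Real.exp_pos _).le]
    simp
  have hGe : ∀ t τ, G t τ = Complex.exp (∑ α, s * τ α) *
      ((∏ i, Real.exp (-(t i + x i) * expForm a i τ) : ℝ) : ℂ) := by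
    intro t τ
    simp only [hG, mellinIntegrand_eq_mul, pow_zero, div_one]
  have hGint : Integrable (Function.uncurry G) ((volume.restrict T).prod volume) := by
    rw [integrable_prod_iff' hGc.aestronglyMeasurable]
    refine ⟨ae_of_all _ fun τ => ?_, ?_⟩
    · simp only [Function.uncurry_apply_pair, hGe]
      exact (integrable_prod_exp_translate x (hU τ)).ofReal.const_mul _
    · refine hint.norm.congr (ae_of_all _ fun τ => ?_)
      simp only [Function.uncurry_apply_pair, hGn]
      rw [integral_const_mul, hT, integral_prod_exp_translate x (hU τ),
        norm_mellinIntegrand_of_nonneg _ _ _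
          (fun i u => mul_nonneg (Real.exp_pos _).le zero_le_one)]
  have hswap := integral_integral_swap hGint
  have hleft : ∫ t in T, ∫ τ, G t τ = ∫ t in T, (∏ α, ((∑ i, (t i + x i) * a i α : ℝ) : ℂ) ^ (-s)) *
      Complex.Gamma s ^ Fintype.card ι := by
    refine setIntegral_congr_fun hTm fun t ht => ?_
    have := mellinForm_exp ha' (y := fun i => t i + x i) (fun i => add_pos (ht i) (hx i)) hs0
    rw [mul_comm]
    exact this
  rw [integral_mul_const] at hleft
  rw [← hleft, hswap, mellinForm]
  refine integral_congr_ae (ae_of_all _ fun τ => ?_)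
  simp only [hGe, mellinIntegrand_eq_mul]
  rw [integral_const_mul, integral_complex_ofReal, hT, integral_prod_exp_translate x (hU τ)]

/-- The Mellin transform of a product of functions `u * exp (-u)`. -/
lemma mellinForm_mul_exp {ι κ : Type*} [Fintype ι] [Nonempty ι] [Fintype κ] {a : κ → ι → ℕ}
    (ha : ∀ i, ∃ α, a i α ≠ 0) (ha' : ∀ α, ∃ i, a i α ≠ 0) {s : ℂ} (hs : 0 < s.re) :
    (∏ α, ((∑ i, (1 : ℝ) * a i α : ℝ) : ℂ) ^ (-s)) * Complex.Gamma s ^ Fintype.card ι =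
      mellinForm a (fun _ => 0) (fun _ => 1) (fun _ u => Real.exp (-1 * u) * u) s := by
  rw [mul_comm, ← mellinForm_exp ha' (y := fun _ => (1 : ℝ)) (fun _ => one_pos) hs]
  simp only [mellinForm, mellinIntegrand_eq_mul, pow_zero, div_one, pow_one]
  refine integral_congr_ae (ae_of_all _ fun τ => ?_)
  simp only [mul_div_assoc, div_self (expForm_pos (ha _) τ).ne', mul_one]

lemma exists_finsupp_of_mem_taylorSpan {κ : Type*} [Fintype κ] {K : ℕ}
    {L : (κ → ℝ → ℝ) → ℝ} (hL : L ∈ taylorSpan κ K) :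
    ∃ c : (κ → ℕ) →₀ ℚ, (∀ k ∈ c.support, ∑ i, k i = K) ∧ ∀ h, L h =
      c.sum fun k a => (a : ℝ) * ∏ i, iteratedDeriv (k i) (h i) 0 := by
  obtain ⟨c, hc, rfl⟩ := (Finsupp.mem_span_image_iff_linearCombination ℚ).1 hL
  refine ⟨c, fun k hk => hc hk, fun h => ?_⟩
  simp [Finsupp.linearCombination_apply, Finsupp.sum, Finset.sum_apply, Rat.smul_def]

/-- The image of `c` under the linear map sending each `k` to `∏ i, f i (k i)`. -/
def umbral {κ : Type*} [Fintype κ] (f : κ → ℕ → MvPolynomial κ ℚ) (c : (κ → ℕ) →₀ ℚ) :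
    MvPolynomial κ ℚ :=
  c.sum fun k a => MvPolynomial.C a * ∏ i, f i (k i)

lemma aeval_umbral {κ : Type*} [Fintype κ] {f : κ → ℕ → MvPolynomial κ ℚ} {x : κ → ℂ}
    {h : κ → ℕ → ℝ} (hf : ∀ i k, MvPolynomial.aeval x (f i k) = (h i k : ℂ))
    (c : (κ → ℕ) →₀ ℚ) : MvPolynomial.aeval x (umbral f c) =
      ((c.sum fun k a => (a : ℝ) * ∏ i, h i (k i) : ℝ) : ℂ) := by
  simp only [umbral, Finsupp.sum, map_sum, map_mul, map_prod, hf, MvPolynomial.aeval_C]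
  push_cast
  simp

lemma isHomogeneous_umbral_neg_X_pow {κ : Type*} [Fintype κ] {c : (κ → ℕ) →₀ ℚ} {K : ℕ}
    (hc : ∀ k ∈ c.support, ∑ i, k i = K) :
    (umbral (fun i k => (-MvPolynomial.X i) ^ k) c).IsHomogeneous K := by
  refine MvPolynomial.IsHomogeneous.sum _ _ _ fun k hk => ?_
  rw [← hc k hk, ← zero_add (∑ i, k i)]
  refine (MvPolynomial.isHomogeneous_C κ (c k)).mul (MvPolynomial.IsHomogeneous.prod _ _ _ ?_)
  intro i _
  simpa using ((MvPolynomial.isHomogeneous_X ℚ i).neg).pow (k i)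

lemma umbral_neg_X_pow_ne_zero {κ : Type*} [Fintype κ] {c : (κ → ℕ) →₀ ℚ} (hc : c ≠ 0) :
    umbral (fun i k => (-MvPolynomial.X i) ^ k) c ≠ 0 := by
  have h : ∀ (k : κ → ℕ) (a : ℚ), MvPolynomial.C a * ∏ i, (-MvPolynomial.X i) ^ k i =
      MvPolynomial.monomial (Finsupp.equivFunOnFinite.symm k) (a * (-1) ^ ∑ i, k i) := by
    intro k a
    rw [MvPolynomial.monomial_eq, Finsupp.prod_fintype _ _ (by simp)]
    simp only [fun i => neg_pow (MvPolynomial.X i : MvPolynomial κ ℚ), Finset.prod_mul_distrib]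
    rw [Finset.prod_pow_eq_pow_sum]
    simp [mul_assoc]
  obtain ⟨k, hk⟩ := Finsupp.ne_iff.1 hc
  intro h0
  have h1 := congrArg (MvPolynomial.coeff (Finsupp.equivFunOnFinite.symm k)) h0
  simp only [umbral, h, Finsupp.sum, MvPolynomial.coeff_sum, MvPolynomial.coeff_monomial,
    EmbeddingLike.apply_eq_iff_eq, Finset.sum_ite_eq', Finsupp.mem_support_iff,
    MvPolynomial.coeff_zero] at h1
  rw [if_pos (by simpa using hk)] at h1
  exact mul_ne_zero (by simpa using hk) (pow_ne_zero _ (by norm_num)) h1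

/-- `e` is zero or has total degree less than `d`. -/
def DegreeBelow {κ : Type*} (d : ℕ) (e : MvPolynomial κ ℚ) : Prop := e = 0 ∨ e.totalDegree < d

lemma DegreeBelow.add {κ : Type*} {d : ℕ} {e f : MvPolynomial κ ℚ} (he : DegreeBelow d e)
    (hf : DegreeBelow d f) : DegreeBelow d (e + f) := by
  rcases he with rfl | he
  · rwa [zero_add]
  rcases hf with rfl | hf
  · rw [add_zero]; exact Or.inr he
  exact Or.inr ((MvPolynomial.totalDegree_add _ _).trans_lt (max_lt he hf))

lemma DegreeBelow.mul {κ : Type*} {d d' : ℕ} {e f : MvPolynomial κ ℚ} (he : DegreeBelow d e)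
    (hf : f.totalDegree ≤ d') : DegreeBelow (d + d') (e * f) := by
  rcases he with rfl | he
  · exact Or.inl (zero_mul _)
  · exact Or.inr ((MvPolynomial.totalDegree_mul _ _).trans_lt (by omega))

lemma DegreeBelow.sum {κ ι : Type*} {d : ℕ} {s : Finset ι} {e : ι → MvPolynomial κ ℚ}
    (he : ∀ i ∈ s, DegreeBelow d (e i)) : DegreeBelow d (∑ i ∈ s, e i) :=
  Finset.sum_induction _ _ (fun _ _ => DegreeBelow.add) (Or.inl rfl) he

lemma totalDegree_prod_le_sum {κ ι : Type*} {s : Finset ι} {k : ι → ℕ}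
    {f : ι → MvPolynomial κ ℚ} (hf : ∀ i, (f i).totalDegree ≤ k i) :
    (∏ i ∈ s, f i).totalDegree ≤ ∑ i ∈ s, k i :=
  (MvPolynomial.totalDegree_finsetProd _ _).trans (Finset.sum_le_sum fun i _ => hf i)

lemma DegreeBelow.prod_sub_prod {κ ι : Type*} {k : ι → ℕ} {f g : ι → MvPolynomial κ ℚ}
    (hf : ∀ i, (f i).totalDegree ≤ k i) (hg : ∀ i, (g i).totalDegree ≤ k i)
    (hfg : ∀ i, DegreeBelow (k i) (f i - g i)) (s : Finset ι) :
    DegreeBelow (∑ i ∈ s, k i) (∏ i ∈ s, f i - ∏ i ∈ s, g i) := by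
  induction s using Finset.induction_on with
  | empty => exact Or.inl (by simp)
  | insert a s ha ih =>
    rw [Finset.prod_insert ha, Finset.prod_insert ha, Finset.sum_insert ha]
    have h1 := ih.mul (hf a)
    have h2 := (hfg a).mul (totalDegree_prod_le_sum (s := s) hg)
    rw [add_comm] at h1
    convert! h1.add h2 using 1
    ring

lemma totalDegree_umbral {κ : Type*} [Fintype κ] {f : κ → ℕ → MvPolynomial κ ℚ}
    (hf : ∀ i k, (f i k).totalDegree ≤ k)
    (hfX : ∀ i k, DegreeBelow k (f i k - (-MvPolynomial.X i) ^ k))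
    {c : (κ → ℕ) →₀ ℚ} {K : ℕ} (hc : ∀ k ∈ c.support, ∑ i, k i = K) (hc0 : c ≠ 0) :
    (umbral f c).totalDegree = K := by
  have hd := (isHomogeneous_umbral_neg_X_pow hc).totalDegree (umbral_neg_X_pow_ne_zero hc0)
  have hX : ∀ (i : κ) (k : ℕ), ((-MvPolynomial.X i : MvPolynomial κ ℚ) ^ k).totalDegree ≤ k := by
    intro i k
    refine (MvPolynomial.totalDegree_pow _ _).trans ?_
    rw [MvPolynomial.totalDegree_neg, MvPolynomial.totalDegree_X, mul_one]
  have hD : DegreeBelow K (umbral f c - umbral (fun i k => (-MvPolynomial.X i) ^ k) c) := by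
    rw [umbral, umbral, Finsupp.sum, Finsupp.sum, ← Finset.sum_sub_distrib]
    refine DegreeBelow.sum fun k hk => ?_
    rw [← mul_sub, mul_comm, ← hc k hk, ← add_zero (∑ i, k i)]
    exact (DegreeBelow.prod_sub_prod (fun i => hf i (k i)) (fun i => hX i (k i))
      (fun i => hfX i (k i)) _).mul (MvPolynomial.totalDegree_C _).le
  rcases hD with h | h
  · rw [sub_eq_zero.1 h, hd]
  · have := MvPolynomial.totalDegree_add_eq_left_of_totalDegree_lt (h.trans_eq hd.symm)
    rwa [add_sub_cancel, hd] at this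

/-- The polynomial in `X i` representing the `k`-th derivative at `0` of `exp (-X i * u) * B u`,
where `b n` is the `n`-th derivative of `B` at `0`. -/
def taylorPoly {κ : Type*} (b : ℕ → ℚ) (i : κ) (k : ℕ) : MvPolynomial κ ℚ :=
  ∑ j ∈ Finset.range (k + 1), MvPolynomial.C (k.choose j * b (k - j)) * (-MvPolynomial.X i) ^ j

lemma totalDegree_C_mul_neg_X_pow_le {κ : Type*} (c : ℚ) (i : κ) (j : ℕ) :
    (MvPolynomial.C c * (-MvPolynomial.X i : MvPolynomial κ ℚ) ^ j).totalDegree ≤ j := by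
  refine (MvPolynomial.totalDegree_mul _ _).trans ?_
  rw [MvPolynomial.totalDegree_C, zero_add]
  refine (MvPolynomial.totalDegree_pow _ _).trans ?_
  rw [MvPolynomial.totalDegree_neg, MvPolynomial.totalDegree_X, mul_one]

lemma totalDegree_taylorPoly_le {κ : Type*} (b : ℕ → ℚ) (i : κ) (k : ℕ) :
    (taylorPoly b i k).totalDegree ≤ k :=
  MvPolynomial.totalDegree_finsetSum_le fun j hj =>
    (totalDegree_C_mul_neg_X_pow_le _ i j).trans (Nat.lt_succ_iff.1 (Finset.mem_range.1 hj))

lemma degreeBelow_taylorPoly {κ : Type*} {b : ℕ → ℚ} (hb : b 0 = 1) (i : κ) (k : ℕ) :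
    DegreeBelow k (taylorPoly b i k - (-MvPolynomial.X i) ^ k) := by
  rw [taylorPoly, Finset.sum_range_succ]
  simp only [Nat.choose_self, Nat.sub_self, hb, Nat.cast_one, mul_one, map_one, one_mul,
    add_sub_cancel_right]
  exact DegreeBelow.sum fun j hj => Or.inr
    ((totalDegree_C_mul_neg_X_pow_le _ i j).trans_lt (Finset.mem_range.1 hj))

lemma aeval_taylorPoly {κ : Type*} {B : ℝ → ℝ} (hB : ContDiff ℝ ∞ B) {b : ℕ → ℚ}
    (hb : ∀ n, iteratedDeriv n B 0 = b n) (x : κ → ℝ) (i : κ) (k : ℕ) :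
    MvPolynomial.aeval (fun i => (x i : ℂ)) (taylorPoly b i k) =
      ((iteratedDeriv k (fun u => Real.exp (-x i * u) * B u) 0 : ℝ) : ℂ) := by
  rw [iteratedDeriv_exp_mul hB, taylorPoly, map_sum]
  simp only [hb, map_mul, map_pow, map_neg, MvPolynomial.aeval_C, MvPolynomial.aeval_X]
  push_cast
  refine Finset.sum_congr rfl fun j _ => ?_
  simp
  ring

/-- The value at `-l` of a function with prescribed Mellin transform is a nonzero homogeneous
polynomial in Taylor coefficients at `0`. -/
lemma exists_value_eq_sum {ι κ : Type*} [Fintype ι] [Nonempty ι] [Fintype κ] {a : κ → ι → ℕ}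
    (ha : ∀ i, ∃ α, a i α ≠ 0) (ha' : ∀ α, ∃ i, a i α ≠ 0) (l : ℕ) :
    ∃ c : (κ → ℕ) →₀ ℚ, (∀ k ∈ c.support, ∑ i, k i = Fintype.card ι * l + Fintype.card κ) ∧
      c ≠ 0 ∧ ∀ h : κ → ℝ → ℝ, (∀ i, RapidlyDecaying (h i)) →
      ∀ F : ℂ → ℂ, MeromorphicOn F Set.univ → AnalyticAt ℂ F (-(l : ℂ)) →
        (∃ σ : ℝ, ∀ s : ℂ, σ < s.re → F s * Complex.Gamma s ^ Fintype.card ι =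
          mellinForm a (fun _ => 0) (fun _ => 1) h s) →
        F (-(l : ℂ)) = ((c.sum fun k a => (a : ℝ) * ∏ i, iteratedDeriv (k i) (h i) 0 : ℝ) : ℂ) := by
  obtain ⟨L, hL, hval⟩ := (hasTaylorLimit_mellinForm ha ha' (l := l)
    (K := Fintype.card ι * l + Fintype.card κ) (fun _ => 0) (fun _ => 1) (fun _ => 0)
    (by simp)).exists_value
  set e : ℚ := ((-1) ^ l * l.factorial) ^ Fintype.card ι with he
  have he0 : ((-1) ^ l / (l.factorial : ℂ)) ^ Fintype.card ι * ((e : ℝ) : ℂ) = 1 := by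
    have h1 : (l.factorial : ℂ) ≠ 0 := by exact_mod_cast l.factorial_ne_zero
    rw [he]
    push_cast
    have h2 : ((-1) ^ l / (l.factorial : ℂ)) * ((-1) ^ l * l.factorial) = 1 := by
      rw [div_mul_eq_mul_div, ← mul_assoc, mul_div_assoc, div_self h1, mul_one, ← mul_pow]
      norm_num
    rw [← mul_pow, h2, one_pow]
  obtain ⟨c, hc, hcL⟩ := exists_finsupp_of_mem_taylorSpan ((taylorSpan κ _).smul_mem e hL)
  have hjet : ∀ h : κ → ℝ → ℝ, jet h (fun _ => 0) = h := fun h => by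
    ext i u
    simp [jet]
  have hmain : ∀ h : κ → ℝ → ℝ, (∀ i, RapidlyDecaying (h i)) →
      ∀ F : ℂ → ℂ, MeromorphicOn F Set.univ → AnalyticAt ℂ F (-(l : ℂ)) →
        (∃ σ : ℝ, ∀ s : ℂ, σ < s.re → F s * Complex.Gamma s ^ Fintype.card ι =
          mellinForm a (fun _ => 0) (fun _ => 1) h s) →
        F (-(l : ℂ)) =
          ((c.sum fun k a => (a : ℝ) * ∏ i, iteratedDeriv (k i) (h i) 0 : ℝ) : ℂ) := by
    intro h hh F hF hFa hFs
    have h1 := hval h hh F hF hFa (by simpa only [hjet] using hFs)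
    rw [← hcL, Pi.smul_apply, Rat.smul_def, Complex.ofReal_mul, ← h1]
    linear_combination -F (-(l : ℂ)) * he0
  refine ⟨c, hc, ?_, hmain⟩
  rintro rfl
  have hpos := linearForm_pos ha' (y := fun _ : κ => (1 : ℝ)) fun _ => one_pos
  have hne : ∀ α, ((∑ i, (1 : ℝ) * a i α : ℝ) : ℂ) ≠ 0 := fun α => by
    exact_mod_cast (hpos α).ne'
  have hdiff : Differentiable ℂ fun s : ℂ => ∏ α, ((∑ i, (1 : ℝ) * a i α : ℝ) : ℂ) ^ (-s) := by
    refine Differentiable.fun_finsetProd fun α _ s => ?_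
    exact differentiableAt_id.neg.const_cpow (Or.inl (hne α))
  have h1 := hmain (fun _ u => Real.exp (-1 * u) * u)
    (fun _ => linearGrowth_id.rapidlyDecaying one_pos) _
    (fun s _ => (hdiff.analyticAt s).meromorphicAt) (hdiff.analyticAt _)
    ⟨0, fun s hs => mellinForm_mul_exp ha ha' hs⟩
  rw [Finsupp.sum_zero_index, Complex.ofReal_zero, Finset.prod_eq_zero_iff] at h1
  obtain ⟨α, -, hα⟩ := h1
  exact hne α ((Complex.cpow_eq_zero_iff _ _).1 hα).1

lemma eq_aeval_umbral_taylorPoly {ι : Type*} [Fintype ι] {r : ℕ} {a : Fin r → ι → ℕ}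
    {c : (Fin r → ℕ) →₀ ℚ} {l : ℕ}
    (hval : ∀ h : Fin r → ℝ → ℝ, (∀ i, RapidlyDecaying (h i)) →
      ∀ F : ℂ → ℂ, MeromorphicOn F Set.univ → AnalyticAt ℂ F (-(l : ℂ)) →
        (∃ σ : ℝ, ∀ s : ℂ, σ < s.re → F s * Complex.Gamma s ^ Fintype.card ι =
          mellinForm a (fun _ => 0) (fun _ => 1) h s) →
        F (-(l : ℂ)) = ((c.sum fun k a => (a : ℝ) * ∏ i, iteratedDeriv (k i) (h i) 0 : ℝ) : ℂ))
    {B : ℝ → ℝ} (hB : LinearGrowth B) {b : ℕ → ℚ} (hb : ∀ n, iteratedDeriv n B 0 = b n)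
    {x : Fin r → ℝ} (hx : ∀ i, 0 < x i) {Z : ℂ → ℂ}
    (hZ : ∀ s : ℂ, (r : ℝ) < s.re → Z s * Complex.Gamma s ^ Fintype.card ι =
      mellinForm a (fun _ => 0) (fun _ => 1) (fun i u => Real.exp (-x i * u) * B u) s) {v : ℂ}
    (hv : ∃ F : ℂ → ℂ, (∀ s : ℂ, (r : ℝ) < s.re → F s = Z s) ∧
      MeromorphicOn F Set.univ ∧ AnalyticAt ℂ F (-(l : ℂ)) ∧ F (-(l : ℂ)) = v) :
    v = MvPolynomial.aeval (fun i => (x i : ℂ)) (umbral (taylorPoly b) c) := by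
  obtain ⟨F, hFs, hF, hFa, rfl⟩ := hv
  rw [hval _ (fun i => hB.rapidlyDecaying (hx i)) F hF hFa
    ⟨r, fun s hs => by rw [hFs s hs, hZ s hs]⟩]
  exact (aeval_umbral (h := fun i k => iteratedDeriv k (fun u => Real.exp (-x i * u) * B u) 0)
    (fun i k => aeval_taylorPoly hB.1 hb x i k) c).symm

lemma taylorPoly_one {κ : Type*} :
    (taylorPoly (fun n => if n = 0 then 1 else 0) : κ → ℕ → MvPolynomial κ ℚ) =
      fun i k => (-MvPolynomial.X i) ^ k := by
  ext1 i
  ext1 k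
  rw [taylorPoly, Finset.sum_range_succ, Finset.sum_eq_zero]
  · simp
  · intro j hj
    have : k - j ≠ 0 := by have := Finset.mem_range.1 hj; omega
    simp [this]

/-- `P_ℓ` and `Q_ℓ` are polynomials with rational coefficients of total degree
`nℓ + r`, and `Q_ℓ` is homogeneous of that degree. -/
theorem Pl_Ql_are_polynomials {r : ℕ} (hr : 0 < r) {E : Type*} [NormedAddCommGroup E]
    [InnerProductSpace ℝ E] (hdim : Module.finrank ℝ E = r)
    (S : RootSystemData r E) (l : ℕ) :
    (∃ p : MvPolynomial (Fin r) ℚ,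
      p.totalDegree = S.pos.card * l + r ∧
      ∀ x : Fin r → ℝ, (∀ i, 0 < x i) → ∀ v : ℂ, IsPValue S l x v →
        v = MvPolynomial.aeval (fun i => (x i : ℂ)) p) ∧
    (∃ q : MvPolynomial (Fin r) ℚ,
      q.totalDegree = S.pos.card * l + r ∧ q.IsHomogeneous (S.pos.card * l + r) ∧
      ∀ x : Fin r → ℝ, (∀ i, 0 < x i) → ∀ v : ℂ, IsQValue S l x v →
        v = MvPolynomial.aeval (fun i => (x i : ℂ)) q) := by
  have : Nonempty S.pos := ⟨⟨_, S.simple_mem_pos ⟨0, hr⟩⟩⟩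
  choose a hpair using fun (i : Fin r) (α : S.pos) => S.exists_nat_pairing α.2 i
  have ha : ∀ i, ∃ α, a i α ≠ 0 := fun i => by
    refine ⟨⟨_, S.simple_mem_pos i⟩, fun h0 => ?_⟩
    have h1 := hpair i ⟨_, S.simple_mem_pos i⟩
    simp [h0, S.pairing_simple] at h1
  have ha' : ∀ α, ∃ i, a i α ≠ 0 := fun α => by
    obtain ⟨i, hi⟩ := S.exists_pairing_ne_zero α.2
    refine ⟨i, fun h0 => hi ?_⟩
    rw [hpair i α, h0, Nat.cast_zero]
  have hprod : ∀ (y : Fin r → ℝ) (s : ℂ),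
      ∏ α ∈ S.pos, ((∑ i, y i * S.pairing i α : ℝ) : ℂ) ^ (-s) =
        ∏ α : S.pos, ((∑ i, y i * a i α : ℝ) : ℂ) ^ (-s) := by
    intro y s
    rw [← Finset.prod_coe_sort]
    simp only [hpair]
  obtain ⟨c, hc, hc0, hval⟩ := exists_value_eq_sum ha ha' l
  have hK : ∀ k ∈ c.support, ∑ i, k i = S.pos.card * l + r := by simpa using hc
  choose b hb using iteratedDeriv_toddFun_zero
  have hb0 : b 0 = 1 := by
    have := hb 0
    rw [iteratedDeriv_zero, toddFun_zero] at this
    exact_mod_cast this.symm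
  refine ⟨⟨umbral (taylorPoly b) c, totalDegree_umbral (totalDegree_taylorPoly_le b)
    (degreeBelow_taylorPoly hb0) hK hc0, fun x hx v hv => ?_⟩,
    ⟨umbral (taylorPoly fun n => if n = 0 then 1 else 0) c,
      totalDegree_umbral (totalDegree_taylorPoly_le _) (degreeBelow_taylorPoly rfl) hK hc0, ?_,
      fun x hx v hv => ?_⟩⟩
  · refine eq_aeval_umbral_taylorPoly hval linearGrowth_toddFun hb hx (fun s hs => ?_) hv
    simp only [zetaRS, hprod]
    exact tsum_mul_gamma_pow ha ha' hx hs
  · rw [taylorPoly_one]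
    exact isHomogeneous_umbral_neg_X_pow hK
  · refine eq_aeval_umbral_taylorPoly hval linearGrowth_one (fun n => ?_) hx (fun s hs => ?_) hv
    · rw [iteratedDeriv_const]
      split_ifs <;> simp
    · simp only [zetaIntRS, hprod]
      exact integral_mul_gamma_pow ha ha' hx (by simpa using hs)
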